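/- arXiv:2502.10926 — 5 statements merged into one kernel-verified Lean document; each statement's English description precedes it below -/
import Mathlib

section
/- Let k be a field and n ≥ 1. Then there exist finitely many pairwise disjoint affine subspaces A_1, …, A_N of the k-vector space of n×n matrices over k such that every n×n matrix over k is similar to exactly one matrix lying in the union A_1 ∪ … ∪ A_N. In other words, the similarity classes of n×n matrices over k admit a representative system which is a finite disjoint union of affine subspaces. -/
open Polynomial

section Cyclic
variable {R : Type*} [CommRing R]

/-- The product of the cyclic modules `R ⧸ (a i)`. -/
abbrev CyclicProd {m : ℕ} (a : Fin m → R) : Type _ := ∀ i, R ⧸ Ideal.span {a i}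

/-- Splitting off the first cyclic factor. -/
noncomputable def CyclicProd.consEquiv {m : ℕ} (x : R) (a : Fin m → R) :
    ((R ⧸ Ideal.span {x}) × CyclicProd a) ≃ₗ[R]
      CyclicProd (Fin.cons x a : Fin (m + 1) → R) :=
  Fin.consLinearEquiv R fun i => R ⧸ Ideal.span {(Fin.cons x a : Fin (m + 1) → R) i}

/-- For coprime `p` and `q`, `R/(gp) × R/(gq) ≃ R/(g) × R/(gpq)`. -/
theorem nonempty_quotient_prod_equiv (g a' b' u v : R) (h : u * a' + v * b' = 1) :
    Nonempty (((R ⧸ Ideal.span {g * a'}) × (R ⧸ Ideal.span {g * b'})) ≃ₗ[R]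
      ((R ⧸ Ideal.span {g}) × (R ⧸ Ideal.span {g * a' * b'}))) := by
  have key : ∀ (p q r : R), q ∣ r * p →
      Ideal.span {p} ≤ Submodule.comap (LinearMap.mulLeft R r) (Ideal.span {q}) := by
    intro p q r hd
    rw [Ideal.span_singleton_le_iff_mem]
    exact Ideal.mem_span_singleton.2 hd
  let f (p q r : R) (hd : q ∣ r * p) : (R ⧸ Ideal.span {p}) →ₗ[R] (R ⧸ Ideal.span {q}) :=
    Submodule.mapQ _ _ (LinearMap.mulLeft R r) (key p q r hd)
  have hf : ∀ (p q r : R) (hd : q ∣ r * p) (x : R),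
      f p q r hd (Ideal.Quotient.mk _ x) = Ideal.Quotient.mk _ (r * x) := fun _ _ _ _ _ => rfl
  let F := LinearMap.prod
    (LinearMap.coprod (f (g * a') g 1 ⟨a', by ring⟩) (f (g * b') g 1 ⟨b', by ring⟩))
    (LinearMap.coprod (f (g * a') (g * a' * b') (-v * b') ⟨-v, by ring⟩)
      (f (g * b') (g * a' * b') (u * a') ⟨u, by ring⟩))
  let G := LinearMap.prod
    (LinearMap.coprod (f g (g * a') (u * a') ⟨u, by ring⟩)
      (f (g * a' * b') (g * a') (-1) ⟨-b', by ring⟩))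
    (LinearMap.coprod (f g (g * b') (v * b') ⟨v, by ring⟩)
      (f (g * a' * b') (g * b') 1 ⟨a', by ring⟩))
  refine ⟨LinearEquiv.ofLinearMap F G ?_ ?_⟩
  · refine LinearMap.ext ?_
    rintro ⟨x, y⟩
    obtain ⟨x, rfl⟩ := Ideal.Quotient.mk_surjective x
    obtain ⟨y, rfl⟩ := Ideal.Quotient.mk_surjective y
    simp only [F, G, LinearMap.comp_apply, LinearMap.prod_apply, Function.prod_apply, LinearMap.coprod_apply,
      hf, ← map_add, LinearMap.id_apply]
    congr 2
    · linear_combination x * h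
    · linear_combination y * h
  · refine LinearMap.ext ?_
    rintro ⟨x, y⟩
    obtain ⟨x, rfl⟩ := Ideal.Quotient.mk_surjective x
    obtain ⟨y, rfl⟩ := Ideal.Quotient.mk_surjective y
    simp only [F, G, LinearMap.comp_apply, LinearMap.prod_apply, Function.prod_apply, LinearMap.coprod_apply,
      hf, ← map_add, LinearMap.id_apply]
    congr 2
    · linear_combination x * h
    · linear_combination y * h

variable [IsDomain R] [IsPrincipalIdealRing R]

theorem exists_eq_mul_of_bezout {a b : R} (ha : a ≠ 0) :
    ∃ g a' b' u v : R, a = g * a' ∧ b = g * b' ∧ u * a' + v * b' = 1 := by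
  obtain ⟨g, hg⟩ := IsPrincipalIdealRing.principal (Ideal.span {a, b})
  have hga : a ∈ Ideal.span {g} := by
    change a ∈ Submodule.span R {g}
    rw [← hg]; exact Ideal.subset_span (by simp)
  have hgb : b ∈ Ideal.span {g} := by
    change b ∈ Submodule.span R {g}
    rw [← hg]; exact Ideal.subset_span (by simp)
  obtain ⟨a', rfl⟩ := Ideal.mem_span_singleton.1 hga
  obtain ⟨b', rfl⟩ := Ideal.mem_span_singleton.1 hgb
  have hgg : g ∈ Ideal.span {g * a', g * b'} := by
    rw [hg]; exact Submodule.mem_span_singleton_self g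
  obtain ⟨u, v, huv⟩ := Ideal.mem_span_pair.1 hgg
  refine ⟨g, a', b', u, v, rfl, rfl, mul_left_cancel₀ (left_ne_zero_of_mul ha) ?_⟩
  linear_combination huv

theorem exists_insert_divisibility_chain {m : ℕ} (x : R) (b : Fin m → R) (hx : x ≠ 0)
    (hb : ∀ i, b i ≠ 0) (hchain : ∀ i j, i ≤ j → b i ∣ b j) :
    ∃ c : Fin (m + 1) → R, (∀ i, c i ≠ 0) ∧ (∀ i j, i ≤ j → c i ∣ c j) ∧
      (∀ y, y ∣ x → (∀ i, y ∣ b i) → ∀ i, y ∣ c i) ∧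
      Nonempty (((R ⧸ Ideal.span {x}) × CyclicProd b) ≃ₗ[R] CyclicProd c) := by
  induction m generalizing x with
  | zero =>
    refine ⟨Fin.cons x b, ?_, ?_, ?_, ⟨CyclicProd.consEquiv x b⟩⟩
    · intro i; fin_cases i; exact hx
    · intro i j _; fin_cases i; fin_cases j; exact dvd_rfl
    · intro y hy _ i; fin_cases i; exact hy
  | succ m ih =>
    obtain ⟨b₀, b, rfl⟩ : ∃ b₀ b', b = Fin.cons b₀ b' := ⟨b 0, Fin.tail b, by simp⟩
    obtain ⟨g, x', b₀', u, v, rfl, rfl, huv⟩ := exists_eq_mul_of_bezout (b := b₀) hx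
    have hb₀ : g * b₀' ≠ 0 := hb 0
    have hb₀b : ∀ i, g * b₀' ∣ b i := fun i => hchain 0 i.succ (Fin.zero_le _)
    obtain ⟨c, hc0, hcc, hcd, ⟨E⟩⟩ := ih (g * x' * b₀') b
      (mul_ne_zero hx (right_ne_zero_of_mul hb₀)) (fun i => hb i.succ)
      (fun i j hij => hchain i.succ j.succ (Fin.succ_le_succ_iff.2 hij))
    have hgc : ∀ i, g ∣ c i := hcd g ⟨x' * b₀', by ring⟩ fun i => (dvd_mul_right _ _).trans (hb₀b i)
    obtain ⟨e⟩ := nonempty_quotient_prod_equiv g x' b₀' u v huv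
    refine ⟨Fin.cons g c, ?_, ?_, ?_, ⟨?_⟩⟩
    · exact Fin.cases (left_ne_zero_of_mul hx) hc0
    · refine Fin.cases (Fin.cases (fun _ => dvd_rfl) fun j _ => hgc j) fun i => Fin.cases ?_ ?_
      · intro h; simp at h
      · intro j h; exact hcc i j (Fin.succ_le_succ_iff.1 h)
    · intro y hyx hyb
      have hyb₀ : y ∣ g * b₀' := hyb 0
      have hyg : y ∣ g := by
        have : g = u * (g * x') + v * (g * b₀') := by linear_combination -g * huv
        rw [this]
        exact dvd_add (hyx.mul_left _) (hyb₀.mul_left _)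
      exact Fin.cases hyg fun i => hyg.trans (hgc i)
    · exact (LinearEquiv.refl R _).prodCongr (CyclicProd.consEquiv (g * b₀') b).symm ≪≫ₗ
        (LinearEquiv.prodAssoc R _ _ _).symm ≪≫ₗ e.prodCongr (LinearEquiv.refl R _) ≪≫ₗ
        LinearEquiv.prodAssoc R _ _ _ ≪≫ₗ (LinearEquiv.refl R _).prodCongr E ≪≫ₗ
        CyclicProd.consEquiv g c

theorem exists_divisibility_chain {m : ℕ} (a : Fin m → R) (ha : ∀ i, a i ≠ 0) :
    ∃ c : Fin m → R, (∀ i, c i ≠ 0) ∧ (∀ i j, i ≤ j → c i ∣ c j) ∧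
      Nonempty (CyclicProd a ≃ₗ[R] CyclicProd c) := by
  induction m with
  | zero => exact ⟨a, ha, fun i => i.elim0, ⟨LinearEquiv.refl R _⟩⟩
  | succ m ih =>
    obtain ⟨a₀, a, rfl⟩ : ∃ a₀ a', a = Fin.cons a₀ a' := ⟨a 0, Fin.tail a, by simp⟩
    obtain ⟨b, hb0, hbc, ⟨e⟩⟩ := ih a fun i => ha i.succ
    obtain ⟨c, hc0, hcc, -, ⟨E⟩⟩ := exists_insert_divisibility_chain a₀ b (ha 0) hb0 hbc
    exact ⟨c, hc0, hcc, ⟨(CyclicProd.consEquiv a₀ a).symm ≪≫ₗ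
      (LinearEquiv.refl R _).prodCongr e ≪≫ₗ E⟩⟩

end Cyclic

section Representation
variable {k : Type*} [Field k]

theorem finite_quotient_span_singleton {f : k[X]} (hf : f ≠ 0) :
    Module.Finite k (k[X] ⧸ Ideal.span {f}) :=
  (AdjoinRoot.powerBasis hf).finite

theorem CyclicProd.finrank_eq {m : ℕ} {f : Fin m → k[X]} (hf : ∀ i, f i ≠ 0) :
    Module.finrank k (CyclicProd f) = ∑ i, (f i).natDegree := by
  have := fun i => finite_quotient_span_singleton (hf i)
  rw [Module.finrank_pi_fintype]
  exact Finset.sum_congr rfl fun i _ => finrank_quotient_span_eq_natDegree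

/-- A family of nonzero elements, each dividing the following ones. -/
def IsDivisibilityChain {R : Type*} [CommRing R] {m : ℕ} (f : Fin m → R) : Prop :=
  (∀ i, f i ≠ 0) ∧ ∀ i j, i ≤ j → f i ∣ f j

/-- Unit cyclic factors may be prepended. -/
noncomputable def CyclicProd.unitConsEquiv {R : Type*} [CommRing R] {m : ℕ} (x : R)
    (hx : IsUnit x) (a : Fin m → R) :
    CyclicProd a ≃ₗ[R] CyclicProd (Fin.cons x a : Fin (m + 1) → R) :=
  have : Subsingleton (R ⧸ Ideal.span {x}) :=
    Ideal.Quotient.subsingleton_iff.2 (Ideal.span_singleton_eq_top.2 hx)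
  have : Unique (R ⧸ Ideal.span {x}) := Unique.mk' _
  LinearEquiv.uniqueProd.symm ≪≫ₗ CyclicProd.consEquiv x a

theorem exists_chain_pad {R : Type*} [CommRing R] [Nontrivial R] {m : ℕ} (d : ℕ) (f : Fin m → R)
    (hf : IsDivisibilityChain f) :
    ∃ c : Fin (m + d) → R, IsDivisibilityChain c ∧
      Nonempty (CyclicProd f ≃ₗ[R] CyclicProd c) := by
  induction d with
  | zero => exact ⟨f, hf, ⟨LinearEquiv.refl R _⟩⟩
  | succ d ih =>
    obtain ⟨c, hc, ⟨e⟩⟩ := ih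
    refine ⟨(Fin.cons 1 c : Fin (m + d + 1) → R), ⟨?_, ?_⟩,
      ⟨e ≪≫ₗ CyclicProd.unitConsEquiv 1 isUnit_one c⟩⟩
    · exact Fin.cases one_ne_zero hc.1
    · refine Fin.cases (fun j _ => one_dvd _) fun i => Fin.cases ?_ ?_
      · intro h; simp at h
      · intro j h; exact hc.2 i j (Fin.succ_le_succ_iff.1 h)

theorem exists_chain_drop {n : ℕ} (d : ℕ) (f : Fin (n + d) → k[X])
    (hf : IsDivisibilityChain f) (hdeg : ∑ i, (f i).natDegree = n) :
    ∃ c : Fin n → k[X], IsDivisibilityChain c ∧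
      Nonempty (CyclicProd f ≃ₗ[k[X]] CyclicProd c) := by
  induction d with
  | zero => exact ⟨f, hf, ⟨LinearEquiv.refl _ _⟩⟩
  | succ d ih =>
    obtain ⟨x, f, rfl⟩ : ∃ x f', f = (Fin.cons x f' : Fin (n + d + 1) → k[X]) :=
      ⟨f 0, Fin.tail f, by simp⟩
    have hx : IsUnit x := by
      by_contra hx
      have h1 : ∀ i, 1 ≤ ((Fin.cons x f : Fin (n + d + 1) → k[X]) i).natDegree := by
        intro i
        by_contra h0
        have hu : IsUnit ((Fin.cons x f : Fin (n + d + 1) → k[X]) i) :=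
          isUnit_iff_degree_eq_zero.2 (by
            rw [degree_eq_natDegree (hf.1 i)]; norm_cast; omega)
        exact hx (isUnit_of_dvd_unit (hf.2 0 i (Fin.zero_le _)) hu)
      have := Finset.sum_le_sum fun i (_ : i ∈ Finset.univ) => h1 i
      erw [hdeg] at this
      simp at this
    have hdeg' : ∑ i, (f i).natDegree = n := by
      have h := hdeg
      erw [Fin.sum_univ_succ] at h
      simpa [natDegree_eq_zero_of_isUnit hx] using h
    obtain ⟨c, hc, ⟨e⟩⟩ := ih f ⟨fun i => hf.1 i.succ,
      fun i j hij => hf.2 i.succ j.succ (Fin.succ_le_succ_iff.2 hij)⟩ hdeg'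
    exact ⟨c, hc, ⟨(CyclicProd.unitConsEquiv x hx f).symm ≪≫ₗ e⟩⟩

/-- `A` acts on `kⁿ` as multiplication by `X` acts on the product of the `k[X] ⧸ (f i)`. -/
def IsRepresentedBy {n m : ℕ} (A : Matrix (Fin n) (Fin n) k) (f : Fin m → k[X]) : Prop :=
  ∃ e : (Fin n → k) ≃ₗ[k] CyclicProd f, ∀ v, e (A.mulVec v) = (X : k[X]) • e v

theorem IsRepresentedBy.sum_natDegree {n m : ℕ} {A : Matrix (Fin n) (Fin n) k} {f : Fin m → k[X]}
    (h : IsRepresentedBy A f) (hf : ∀ i, f i ≠ 0) : ∑ i, (f i).natDegree = n := by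
  obtain ⟨e, -⟩ := h
  rw [← CyclicProd.finrank_eq hf, ← e.finrank_eq]
  simp

theorem IsRepresentedBy.congr {n m m' : ℕ} {A : Matrix (Fin n) (Fin n) k} {f : Fin m → k[X]}
    {g : Fin m' → k[X]} (h : IsRepresentedBy A f) (e : CyclicProd f ≃ₗ[k[X]] CyclicProd g) :
    IsRepresentedBy A g := by
  obtain ⟨e', he'⟩ := h
  refine ⟨e' ≪≫ₗ e.restrictScalars k, fun v => ?_⟩
  simp [he']

theorem exists_isRepresentedBy_ne_zero {n : ℕ} (A : Matrix (Fin n) (Fin n) k) :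
    ∃ (m : ℕ) (f : Fin m → k[X]), (∀ i, f i ≠ 0) ∧ IsRepresentedBy A f := by
  let φ := A.mulVecLin
  have htors : Module.IsTorsion k[X] (Module.AEval' φ) :=
    Module.AEval.isTorsion_of_finiteDimensional k (Fin n → k) φ
  obtain ⟨ι, _, p, hp, e, ⟨E⟩⟩ := Module.equiv_directSum_of_isTorsion htors
  classical
  let σ := Fintype.equivFin ι
  refine ⟨Fintype.card ι, fun i => p (σ.symm i) ^ e (σ.symm i),
    fun i => pow_ne_zero _ (hp _).ne_zero, ?_⟩
  let E' : Module.AEval' φ ≃ₗ[k[X]]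
      CyclicProd (fun i : Fin (Fintype.card ι) => p (σ.symm i) ^ e (σ.symm i)) :=
    E ≪≫ₗ DirectSum.linearEquivFunOnFintype k[X] ι _ ≪≫ₗ
      LinearEquiv.piCongrLeft' k[X] (fun i => k[X] ⧸ Ideal.span {p i ^ e i}) σ
  refine ⟨Module.AEval'.of φ ≪≫ₗ E'.restrictScalars k, fun v => ?_⟩
  change E' (Module.AEval'.of φ (φ v)) = X • E' (Module.AEval'.of φ v)
  rw [← map_smul, Module.AEval'.X_smul_of]

theorem exists_isRepresentedBy_chain {n : ℕ} (A : Matrix (Fin n) (Fin n) k) :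
    ∃ f : Fin n → k[X], (∀ i, (f i).Monic) ∧ (∀ i j, i ≤ j → f i ∣ f j) ∧
      IsRepresentedBy A f := by
  classical
  obtain ⟨m, a, ha, hA⟩ := exists_isRepresentedBy_ne_zero A
  obtain ⟨b, hb0, hbc, ⟨e⟩⟩ := exists_divisibility_chain a ha
  have hAb := hA.congr e
  obtain ⟨c, hc, ⟨E⟩⟩ : ∃ c : Fin n → k[X], IsDivisibilityChain c ∧
      Nonempty (CyclicProd b ≃ₗ[k[X]] CyclicProd c) := by
    rcases le_total m n with h | h
    · obtain ⟨d, rfl⟩ := Nat.exists_eq_add_of_le h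
      exact exists_chain_pad d b ⟨hb0, hbc⟩
    · obtain ⟨d, rfl⟩ := Nat.exists_eq_add_of_le h
      exact exists_chain_drop d b ⟨hb0, hbc⟩ (hAb.sum_natDegree hb0)
  refine ⟨fun i => normalize (c i), fun i => monic_normalize (hc.1 i),
    fun i j hij => normalize_dvd_iff.2 (dvd_normalize_iff.2 (hc.2 i j hij)),
    (hAb.congr E).congr (LinearEquiv.piCongrRight fun i => Submodule.quotEquivOfEq _ _ ?_)⟩
  exact Ideal.span_singleton_eq_span_singleton.2 (associated_normalize _)

theorem IsRepresentedBy.exists_conj {n m : ℕ} {A B : Matrix (Fin n) (Fin n) k} {f : Fin m → k[X]}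
    (hA : IsRepresentedBy A f) (hB : IsRepresentedBy B f) :
    ∃ T : (Matrix (Fin n) (Fin n) k)ˣ,
      (↑T⁻¹ : Matrix (Fin n) (Fin n) k) * A * (↑T : Matrix (Fin n) (Fin n) k) = B := by
  obtain ⟨e, he⟩ := hA
  obtain ⟨e', he'⟩ := hB
  let E := e' ≪≫ₗ e.symm
  let T : (Matrix (Fin n) (Fin n) k)ˣ :=
    ⟨LinearMap.toMatrix' E.toLinearMap, LinearMap.toMatrix' E.symm.toLinearMap,
      by rw [← LinearMap.toMatrix'_comp]; simp, by rw [← LinearMap.toMatrix'_comp]; simp⟩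
  refine ⟨T, ?_⟩
  rw [mul_assoc, Units.inv_mul_eq_iff_eq_mul]
  apply Matrix.mulVec_injective
  ext1 v
  have hT : ∀ v, (↑T : Matrix (Fin n) (Fin n) k).mulVec v = E v := fun v =>
    LinearMap.toMatrix'_mulVec E.toLinearMap v
  rw [← Matrix.mulVec_mulVec, ← Matrix.mulVec_mulVec, hT, hT]
  apply e.injective
  simp [E, he, he']

theorem IsRepresentedBy.conj {n m : ℕ} {A : Matrix (Fin n) (Fin n) k} {f : Fin m → k[X]}
    (hA : IsRepresentedBy A f) (T : (Matrix (Fin n) (Fin n) k)ˣ) :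
    IsRepresentedBy ((↑T⁻¹ : Matrix (Fin n) (Fin n) k) * A * (↑T : Matrix (Fin n) (Fin n) k))
      f := by
  obtain ⟨e, he⟩ := hA
  refine ⟨LinearEquiv.ofLinearMap (Matrix.mulVecLin ↑T) (Matrix.mulVecLin ↑T⁻¹) ?_ ?_ ≪≫ₗ e,
    fun v => ?_⟩
  · rw [← Matrix.mulVecLin_mul]; simp
  · rw [← Matrix.mulVecLin_mul]; simp
  · simp [← he, Matrix.mulVec_mulVec, ← mul_assoc]

theorem lsmul_quotient_mk (I : Ideal k[X]) (h x : k[X]) :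
    Algebra.lsmul k k (k[X] ⧸ I) h (Ideal.Quotient.mk I x) = Ideal.Quotient.mk I (h * x) := rfl

/-- The rank over `k` of multiplication by `h` on `k[X] ⧸ (f)`. -/
noncomputable def smulRank (h f : k[X]) : ℕ :=
  Module.finrank k (LinearMap.range (Algebra.lsmul k k (k[X] ⧸ Ideal.span {f}) h))

theorem smulRank_eq_zero_iff {h f : k[X]} (hf : f ≠ 0) : smulRank h f = 0 ↔ f ∣ h := by
  have := finite_quotient_span_singleton hf
  rw [smulRank, Submodule.finrank_eq_zero, LinearMap.range_eq_bot]
  constructor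
  · intro H
    have := LinearMap.congr_fun H (Ideal.Quotient.mk _ 1)
    rwa [lsmul_quotient_mk, LinearMap.zero_apply, mul_one,
      Ideal.Quotient.eq_zero_iff_dvd] at this
  · intro H
    refine LinearMap.ext fun x => ?_
    obtain ⟨x, rfl⟩ := Ideal.Quotient.mk_surjective x
    rw [lsmul_quotient_mk, LinearMap.zero_apply, Ideal.Quotient.eq_zero_iff_dvd]
    exact H.mul_right _

theorem CyclicProd.finrank_range_lsmul {m : ℕ} {f : Fin m → k[X]} (hf : ∀ i, f i ≠ 0)
    (h : k[X]) :
    Module.finrank k (LinearMap.range (Algebra.lsmul k k (CyclicProd f) h)) =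
      ∑ i, smulRank h (f i) := by
  have := fun i => finite_quotient_span_singleton (hf i)
  have hmem : ∀ x : CyclicProd f, x ∈ LinearMap.range (Algebra.lsmul k k (CyclicProd f) h) ↔
      ∀ i, x i ∈ LinearMap.range (Algebra.lsmul k k (k[X] ⧸ Ideal.span {f i}) h) := by
    intro x
    constructor
    · rintro ⟨y, rfl⟩ i
      exact ⟨y i, rfl⟩
    · intro H
      choose y hy using H
      exact ⟨y, funext hy⟩
  let E : LinearMap.range (Algebra.lsmul k k (CyclicProd f) h) ≃ₗ[k]
      ∀ i, LinearMap.range (Algebra.lsmul k k (k[X] ⧸ Ideal.span {f i}) h) :=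
    { toFun := fun x i => ⟨x.1 i, (hmem x.1).1 x.2 i⟩
      invFun := fun y => ⟨fun i => (y i).1, (hmem _).2 fun i => (y i).2⟩
      map_add' := fun _ _ => rfl
      map_smul' := fun _ _ => rfl
      left_inv := fun _ => rfl
      right_inv := fun _ => rfl }
  have := fun i => Module.Free.of_divisionRing k
    (LinearMap.range (Algebra.lsmul k k (k[X] ⧸ Ideal.span {f i}) h))
  rw [E.finrank_eq, Module.finrank_pi_fintype]
  rfl

theorem IsRepresentedBy.sum_smulRank_eq {n m m' : ℕ} {A : Matrix (Fin n) (Fin n) k}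
    {f : Fin m → k[X]} {g : Fin m' → k[X]} (hf : ∀ i, f i ≠ 0) (hg : ∀ i, g i ≠ 0)
    (hAf : IsRepresentedBy A f) (hAg : IsRepresentedBy A g) (h : k[X]) :
    ∑ i, smulRank h (f i) = ∑ i, smulRank h (g i) := by
  obtain ⟨e, he⟩ := hAf
  obtain ⟨e', he'⟩ := hAg
  let E := e.symm ≪≫ₗ e'
  have hX : ∀ v, E ((X : k[X]) • v) = (X : k[X]) • E v := by
    intro v
    obtain ⟨w, rfl⟩ := e.surjective v
    simp [E, ← he, ← he']
  have hE : ∀ (p : k[X]) v, E (p • v) = p • E v := by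
    intro p
    induction p using Polynomial.induction_on with
    | C a =>
      intro v
      have hC : ∀ {l : ℕ} (q : Fin l → k[X]) (w : CyclicProd q), (C a : k[X]) • w = a • w :=
        fun q w => algebraMap_smul k[X] a w
      rw [hC, hC, map_smul]
    | add p q hp hq => intro v; rw [add_smul, add_smul, map_add, hp, hq]
    | monomial l a ih => intro v; rw [pow_succ, ← mul_assoc, mul_smul, ih, hX, ← mul_smul]
  rw [← CyclicProd.finrank_range_lsmul hf, ← CyclicProd.finrank_range_lsmul hg,
    (E.submoduleMap (LinearMap.range (Algebra.lsmul k k (CyclicProd f) h))).finrank_eq,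
    ← LinearMap.range_comp]
  have hcomp : (E : CyclicProd f →ₗ[k] CyclicProd g) ∘ₗ Algebra.lsmul k k (CyclicProd f) h =
      Algebra.lsmul k k (CyclicProd g) h ∘ₗ (E : CyclicProd f →ₗ[k] CyclicProd g) :=
    LinearMap.ext fun v => hE h v
  rw [hcomp, LinearMap.range_comp_of_range_eq_top _ E.range]

theorem eq_of_sum_smulRank_eq {m : ℕ} {f g : Fin m → k[X]} (hf : ∀ i, (f i).Monic)
    (hg : ∀ i, (g i).Monic) (hfc : ∀ i j, i ≤ j → f i ∣ f j) (hgc : ∀ i j, i ≤ j → g i ∣ g j)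
    (H : ∀ h, ∑ i, smulRank h (f i) = ∑ i, smulRank h (g i)) : f = g := by
  have dvd : ∀ {f g : Fin m → k[X]}, (∀ i, (f i).Monic) → (∀ i, (g i).Monic) →
      (∀ i j, i ≤ j → f i ∣ f j) → (∀ h, ∑ i, smulRank h (f i) = ∑ i, smulRank h (g i)) →
      ∀ j, (∀ i, j < i → f i = g i) → g j ∣ f j := by
    intro f g hf hg hfc H j hj
    rw [← smulRank_eq_zero_iff (hg j).ne_zero]
    have hle : ∀ i, smulRank (f j) (f i) ≤ smulRank (f j) (g i) := by
      intro i
      rcases le_or_gt i j with hij | hij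
      · rw [(smulRank_eq_zero_iff (hf i).ne_zero).2 (hfc i j hij)]
        exact Nat.zero_le _
      · rw [hj i hij]
    have := (Finset.sum_eq_sum_iff_of_le fun i _ => hle i).1 (H (f j)) j (Finset.mem_univ j)
    rw [← this, smulRank_eq_zero_iff (hf j).ne_zero]
  funext j
  induction j using WellFoundedGT.induction with
  | _ j ih =>
    exact eq_of_monic_of_associated (hf j) (hg j)
      (associated_of_dvd_dvd (dvd hg hf hgc (fun h => (H h).symm) j fun i hi => (ih i hi).symm)
        (dvd hf hg hfc H j ih))

end Representation

section Hessenberg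
variable {k : Type*} [Field k]

/-- The characteristic polynomials of the leading principal submatrices of the Hessenberg matrix
with subdiagonal entries `1` and entries `-h s t` for `s ≤ t`. -/
noncomputable def hessenbergPoly (h : ℕ → ℕ → k) : ℕ → k[X]
  | 0 => 1
  | t + 1 => X * hessenbergPoly h t + ∑ s : Fin (t + 1), C (h s t) * hessenbergPoly h s
termination_by t => t
decreasing_by
  · exact Nat.lt_succ_self _
  · exact s.2

theorem hessenbergPoly_zero (h : ℕ → ℕ → k) : hessenbergPoly h 0 = 1 := by
  rw [hessenbergPoly]

theorem hessenbergPoly_succ (h : ℕ → ℕ → k) (t : ℕ) :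
    hessenbergPoly h (t + 1) =
      X * hessenbergPoly h t + ∑ s ∈ Finset.range (t + 1), C (h s t) * hessenbergPoly h s := by
  rw [hessenbergPoly, Finset.sum_range]

theorem hessenbergPoly_monic_and_natDegree (h : ℕ → ℕ → k) (t : ℕ) :
    (hessenbergPoly h t).Monic ∧ (hessenbergPoly h t).natDegree = t := by
  induction t using Nat.strong_induction_on with
  | _ t ih =>
    cases t with
    | zero => simp [hessenbergPoly_zero]
    | succ t =>
      obtain ⟨hm, hd⟩ := ih t (Nat.lt_succ_self t)
      have hXm : (X * hessenbergPoly h t).Monic := monic_X.mul hm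
      have hXd : (X * hessenbergPoly h t).natDegree = t + 1 := by
        rw [natDegree_X_mul hm.ne_zero, hd]
      have hlt : (∑ s ∈ Finset.range (t + 1), C (h s t) * hessenbergPoly h s).degree <
          (X * hessenbergPoly h t).degree := by
        rw [degree_eq_natDegree hXm.ne_zero, hXd]
        refine lt_of_le_of_lt (degree_sum_le _ _) ((Finset.sup_lt_iff (WithBot.bot_lt_coe _)).2 ?_)
        intro s hs
        have hs' := Finset.mem_range.1 hs
        rw [← smul_eq_C_mul]
        refine lt_of_le_of_lt (degree_smul_le _ _) ?_
        rw [degree_eq_natDegree (ih s hs').1.ne_zero, (ih s hs').2]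
        exact_mod_cast hs'
      rw [hessenbergPoly_succ]
      exact ⟨hXm.add_of_left hlt, by rw [natDegree_add_eq_left_of_degree_lt hlt, hXd]⟩

theorem hessenbergPoly_monic (h : ℕ → ℕ → k) (t : ℕ) : (hessenbergPoly h t).Monic :=
  (hessenbergPoly_monic_and_natDegree h t).1

theorem natDegree_hessenbergPoly (h : ℕ → ℕ → k) (t : ℕ) : (hessenbergPoly h t).natDegree = t :=
  (hessenbergPoly_monic_and_natDegree h t).2

/-- The entries of the Hessenberg matrix attached to `h`. -/
def hessenbergEntry (h : ℕ → ℕ → k) (s t : ℕ) : k :=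
  (if s = t + 1 then 1 else 0) - if s ≤ t then h s t else 0

theorem linearIndependent_mk_hessenbergPoly (h : ℕ → ℕ → k) (N : ℕ) :
    LinearIndependent k fun t : Fin N =>
      Ideal.Quotient.mk (Ideal.span {hessenbergPoly h N}) (hessenbergPoly h t) := by
  let S : Polynomial.Sequence k :=
    { elems' := hessenbergPoly h
      degree_eq' := fun i => by
        rw [degree_eq_natDegree (hessenbergPoly_monic h i).ne_zero, natDegree_hessenbergPoly] }
  have hS : LinearIndependent k fun t : Fin N => hessenbergPoly h t :=
    S.linearIndependent.comp _ Fin.val_injective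
  rw [Fintype.linearIndependent_iff] at hS ⊢
  intro a ha
  apply hS
  have hsum : Ideal.Quotient.mk (Ideal.span {hessenbergPoly h N})
      (∑ t : Fin N, a t • hessenbergPoly h t) = 0 := by
    rw [map_sum]; exact ha
  rw [Ideal.Quotient.eq_zero_iff_dvd] at hsum
  refine eq_zero_of_dvd_of_degree_lt hsum ?_
  rw [degree_eq_natDegree (hessenbergPoly_monic h N).ne_zero, natDegree_hessenbergPoly]
  refine lt_of_le_of_lt (degree_sum_le _ _) ((Finset.sup_lt_iff (WithBot.bot_lt_coe _)).2 ?_)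
  intro s _
  refine lt_of_le_of_lt (degree_smul_le _ _) ?_
  rw [degree_eq_natDegree (hessenbergPoly_monic h s).ne_zero, natDegree_hessenbergPoly]
  exact_mod_cast s.2

theorem X_smul_mk_hessenbergPoly (h : ℕ → ℕ → k) (N : ℕ) (t : Fin N) :
    (X : k[X]) • Ideal.Quotient.mk (Ideal.span {hessenbergPoly h N}) (hessenbergPoly h t) =
      ∑ s : Fin N, hessenbergEntry h s t •
        Ideal.Quotient.mk (Ideal.span {hessenbergPoly h N}) (hessenbergPoly h s) := by
  have ht := t.2
  have hpoly : X * hessenbergPoly h t =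
      ∑ s ∈ Finset.range (N + 1), hessenbergEntry h s t • hessenbergPoly h s := by
    have h1 : ∑ s ∈ Finset.range (N + 1),
        (if s = (t : ℕ) + 1 then (1 : k) else 0) • hessenbergPoly h s =
          hessenbergPoly h (t + 1) := by
      simp only [ite_smul, one_smul, zero_smul, Finset.sum_ite_eq', Finset.mem_range]
      rw [if_pos (by omega)]
    have h2 : ∑ s ∈ Finset.range (N + 1),
        (if s ≤ (t : ℕ) then h s t else 0) • hessenbergPoly h s =
          ∑ s ∈ Finset.range (t + 1), C (h s t) * hessenbergPoly h s := by
      rw [← Finset.sum_subset (s₁ := Finset.range (t + 1))]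
      · refine Finset.sum_congr rfl fun s hs => ?_
        rw [if_pos (Nat.lt_succ_iff.1 (Finset.mem_range.1 hs)), smul_eq_C_mul]
      · exact Finset.range_mono (by omega)
      · intro s _ hs
        rw [if_neg (fun hst => hs (Finset.mem_range.2 (Nat.lt_succ_iff.2 hst))), zero_smul]
    simp only [hessenbergEntry, sub_smul, Finset.sum_sub_distrib]
    rw [h1, h2, hessenbergPoly_succ]
    ring
  have hmk := congrArg (Ideal.Quotient.mk (Ideal.span {hessenbergPoly h N})) hpoly
  rw [map_sum, Finset.sum_range_succ, Finset.sum_range] at hmk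
  have hz : Ideal.Quotient.mk (Ideal.span {hessenbergPoly h N})
      (hessenbergEntry h N t • hessenbergPoly h N) = 0 :=
    Ideal.Quotient.eq_zero_iff_dvd _ _ |>.2 (by rw [smul_eq_C_mul]; exact dvd_mul_left _ _)
  rw [hz, add_zero] at hmk
  exact hmk

/-- The images of the Hessenberg polynomials form a basis of `k[X] ⧸ (hessenbergPoly h N)`. -/
noncomputable def hessenbergBasis (h : ℕ → ℕ → k) (N : ℕ) :
    Module.Basis (Fin N) k (k[X] ⧸ Ideal.span {hessenbergPoly h N}) :=
  have := finite_quotient_span_singleton (hessenbergPoly_monic h N).ne_zero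
  basisOfLinearIndependentOfCardEqFinrank' _ (linearIndependent_mk_hessenbergPoly h N) (by
    rw [finrank_quotient_span_eq_natDegree, natDegree_hessenbergPoly, Fintype.card_fin])

theorem hessenbergBasis_apply (h : ℕ → ℕ → k) (N : ℕ) (t : Fin N) :
    hessenbergBasis h N t =
      Ideal.Quotient.mk (Ideal.span {hessenbergPoly h N}) (hessenbergPoly h t) := by
  simp [hessenbergBasis]

/-- The block diagonal matrix of leading Hessenberg blocks of sizes `N i`, reindexed by `σ`. -/
def hessenbergBlocks {n m : ℕ} (N : Fin m → ℕ) (σ : (Σ i, Fin (N i)) ≃ Fin n) (h : ℕ → ℕ → k) :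
    Matrix (Fin n) (Fin n) k :=
  Matrix.reindex σ σ (Matrix.blockDiagonal' fun i =>
    Matrix.of fun s t : Fin (N i) => hessenbergEntry h s t)

theorem hessenbergBlocks_isRepresentedBy {n m : ℕ} (N : Fin m → ℕ)
    (σ : (Σ i, Fin (N i)) ≃ Fin n) (h : ℕ → ℕ → k) :
    IsRepresentedBy (hessenbergBlocks N σ h) fun i => hessenbergPoly h (N i) := by
  classical
  let f : Fin m → k[X] := fun i => hessenbergPoly h (N i)
  let B : Module.Basis (Σ i, Fin (N i)) k (CyclicProd f) :=
    Pi.basis fun i => hessenbergBasis h (N i)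
  have hB : ∀ j t, B ⟨j, t⟩ = Pi.single j (Ideal.Quotient.mk _ (hessenbergPoly h t)) := by
    intro j t
    rw [Pi.basis_apply, hessenbergBasis_apply]
  let e := (B.reindex σ).equivFun.symm
  have he : ∀ v, e v = ∑ p, v (σ p) • B p := by
    intro v
    rw [Module.Basis.equivFun_symm_apply, ← σ.sum_comp]
    simp
  have hX : ∀ p, (X : k[X]) • B p = ∑ q, hessenbergBlocks N σ h (σ q) (σ p) • B q := by
    rintro ⟨j, t⟩
    rw [Fintype.sum_sigma, Finset.sum_eq_single j]
    · rw [hB, ← Pi.single_smul, X_smul_mk_hessenbergPoly]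
      have : ∀ s, hessenbergBlocks N σ h (σ ⟨j, s⟩) (σ ⟨j, t⟩) = hessenbergEntry h s t := by
        intro s
        simp [hessenbergBlocks]
      simp only [this, hB, ← Pi.single_smul]
      exact map_sum (AddMonoidHom.single (fun i => k[X] ⧸ Ideal.span {f i}) j) _ _
    · intro i _ hij
      refine Finset.sum_eq_zero fun s _ => ?_
      simp [hessenbergBlocks, Matrix.blockDiagonal'_apply_ne _ _ _ hij]
    · simp
  refine ⟨e, fun v => ?_⟩
  simp only [he, Finset.smul_sum, Matrix.mulVec, dotProduct, Finset.sum_smul]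
  rw [Finset.sum_comm, ← σ.sum_comp]
  refine Finset.sum_congr rfl fun p _ => ?_
  rw [smul_comm, hX, Finset.smul_sum]
  refine Finset.sum_congr rfl fun q _ => ?_
  rw [smul_smul, mul_comm]

end Hessenberg

section NormalForm
variable {k : Type*} [Field k] {n : ℕ}

/-- `s ≤ t` and `t` is the last index of the interval `[D i, D (i + 1))` containing `s`. -/
def IsBlockEnd (D : Fin (n + 1) → ℕ) (s t : ℕ) : Prop :=
  ∃ i : Fin n, D i.castSucc ≤ s ∧ s ≤ t ∧ t + 1 = D i.succ

open Classical in
/-- The array placing the coefficient `c s` at the end of the block containing `s`. -/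
noncomputable def blockArray (D : Fin (n + 1) → ℕ) (c : ℕ → k) (s t : ℕ) : k :=
  if IsBlockEnd D s t then c s else 0

theorem eq_of_mem_block {D : Fin (n + 1) → ℕ} (hD : Monotone D) {i j : Fin n} {s : ℕ}
    (hi : D i.castSucc ≤ s) (hi' : s < D i.succ) (hj : D j.castSucc ≤ s) (hj' : s < D j.succ) :
    i = j := by
  rcases lt_trichotomy i j with h | h | h
  · have := hD (show i.succ ≤ j.castSucc from h)
    omega
  · exact h
  · have := hD (show j.succ ≤ i.castSucc from h)
    omega

theorem isBlockEnd_iff {D : Fin (n + 1) → ℕ} (hD : Monotone D) {i : Fin n} {s t : ℕ}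
    (ht : D i.castSucc ≤ t) (ht' : t < D i.succ) :
    IsBlockEnd D s t ↔ D i.castSucc ≤ s ∧ s ≤ t ∧ t + 1 = D i.succ := by
  refine ⟨?_, fun h => ⟨i, h⟩⟩
  rintro ⟨j, hj, hst, htj⟩
  obtain rfl := eq_of_mem_block hD ht ht' (hj.trans hst) (by omega)
  exact ⟨hj, hst, htj⟩

/-- The monic polynomial of degree `d` with lower coefficients `c r, …, c (r + d - 1)`. -/
noncomputable def blockPoly (c : ℕ → k) (r d : ℕ) : k[X] :=
  X ^ d + ∑ l ∈ Finset.range d, C (c (r + l)) * X ^ l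

theorem coeff_blockPoly (c : ℕ → k) (r : ℕ) {d l : ℕ} (hl : l < d) :
    (blockPoly c r d).coeff l = c (r + l) := by
  simp [blockPoly, coeff_X_pow, hl, hl.ne]

theorem hessenbergPoly_add {D : Fin (n + 1) → ℕ} (hD : Monotone D) (c : ℕ → k) (i : Fin n)
    (l : ℕ) (hl : D i.castSucc + l < D i.succ) :
    hessenbergPoly (blockArray D c) (D i.castSucc + l) =
      X ^ l * hessenbergPoly (blockArray D c) (D i.castSucc) := by
  induction l with
  | zero => simp
  | succ l ih =>
    rw [← add_assoc, hessenbergPoly_succ, ih (by omega), Finset.sum_eq_zero, pow_succ]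
    · ring
    · intro s _
      have : ¬ IsBlockEnd D s (D i.castSucc + l) := by
        rw [isBlockEnd_iff hD (i := i) (by omega) (by omega)]
        omega
      simp [blockArray, this]

theorem hessenbergPoly_block {D : Fin (n + 1) → ℕ} (hD : Monotone D) (c : ℕ → k) (i : Fin n) :
    hessenbergPoly (blockArray D c) (D i.succ) =
      blockPoly c (D i.castSucc) (D i.succ - D i.castSucc) *
        hessenbergPoly (blockArray D c) (D i.castSucc) := by
  obtain ⟨d, hd⟩ := Nat.exists_eq_add_of_le (hD (Fin.castSucc_lt_succ (i := i)).le)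
  rw [hd, Nat.add_sub_cancel_left]
  cases d with
  | zero => simp [blockPoly]
  | succ d =>
    rw [← add_assoc, hessenbergPoly_succ, hessenbergPoly_add hD c i d (by omega), add_assoc,
      Finset.sum_range_add, Finset.sum_eq_zero, zero_add, blockPoly, add_mul, Finset.sum_mul,
      pow_succ]
    · congr 1
      · ring
      · refine Finset.sum_congr rfl fun l hl => ?_
        have hl' := Finset.mem_range.1 hl
        have : IsBlockEnd D (D i.castSucc + l) (D i.castSucc + d) :=
          ⟨i, by omega, by omega, by omega⟩
        rw [hessenbergPoly_add hD c i l (by omega), blockArray, if_pos this]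
        ring
    · intro s hs
      have hs' := Finset.mem_range.1 hs
      have : ¬ IsBlockEnd D s (D i.castSucc + d) := by
        rw [isBlockEnd_iff hD (i := i) (by omega) (by omega)]
        omega
      simp [blockArray, this]

theorem exists_hessenbergPoly_eq (F : Fin (n + 1) → k[X]) (hF : ∀ i, (F i).Monic) (hF0 : F 0 = 1)
    (hFc : ∀ i : Fin n, F i.castSucc ∣ F i.succ) (hD : Monotone fun i => (F i).natDegree) :
    ∃ c : ℕ → k, ∀ i, hessenbergPoly (blockArray (fun i => (F i).natDegree) c)
      (F i).natDegree = F i := by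
  classical
  choose g hg using hFc
  have hgm : ∀ i, (g i).Monic := fun i => (hF i.castSucc).of_mul_monic_left (hg i ▸ hF i.succ)
  have hgd : ∀ i : Fin n, (F i.succ).natDegree = (F i.castSucc).natDegree + (g i).natDegree := by
    intro i
    rw [hg i, (hF i.castSucc).natDegree_mul (hgm i)]
  have hc : ∀ s, ∃ x : k, ∀ i : Fin n, (F i.castSucc).natDegree ≤ s → s < (F i.succ).natDegree →
      x = (g i).coeff (s - (F i.castSucc).natDegree) := by
    intro s
    by_cases h : ∃ i : Fin n, (F i.castSucc).natDegree ≤ s ∧ s < (F i.succ).natDegree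
    · obtain ⟨i, hi, hi'⟩ := h
      refine ⟨(g i).coeff (s - (F i.castSucc).natDegree), fun j hj hj' => ?_⟩
      obtain rfl := eq_of_mem_block hD hi hi' hj hj'
      rfl
    · exact ⟨0, fun i hi hi' => (h ⟨i, hi, hi'⟩).elim⟩
  choose c hc using hc
  refine ⟨c, fun i => ?_⟩
  induction i using Fin.induction with
  | zero => simp [hF0, hessenbergPoly_zero]
  | succ i ih =>
    rw [hessenbergPoly_block hD, ih, hg i, mul_comm]
    congr 1
    rw [← hg i, hgd, Nat.add_sub_cancel_left]
    refine Eq.trans ?_ (hgm i).as_sum.symm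
    rw [blockPoly]
    congr 1
    refine Finset.sum_congr rfl fun l hl => ?_
    have hl' := Finset.mem_range.1 hl
    rw [hc _ i (by omega) (by have := hgd i; omega), Nat.add_sub_cancel_left]

theorem blockArray_eq_of_hessenbergPoly_eq {D : Fin (n + 1) → ℕ} (hD : Monotone D) {c c' : ℕ → k}
    (h : ∀ i, hessenbergPoly (blockArray D c) (D i) = hessenbergPoly (blockArray D c') (D i)) :
    blockArray D c = blockArray D c' := by
  funext s t
  by_cases hst : IsBlockEnd D s t
  · rw [blockArray, blockArray, if_pos hst, if_pos hst]
    obtain ⟨i, hi, hst, ht⟩ := hst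
    have hmul := h i.succ
    rw [hessenbergPoly_block hD, hessenbergPoly_block hD, h i.castSucc] at hmul
    have hcoeff := congrArg (fun p => p.coeff (s - D i.castSucc))
      (mul_right_cancel₀ (hessenbergPoly_monic _ _).ne_zero hmul)
    rwa [coeff_blockPoly _ _ (by omega), coeff_blockPoly _ _ (by omega),
      Nat.add_sub_cancel' hi] at hcoeff
  · rw [blockArray, blockArray, if_neg hst, if_neg hst]

/-- Possible degree sequences of the invariant factors of an `n × n` matrix, starting with `0`. -/
abbrev DegreeSequence (n : ℕ) : Type :=
  {D : Fin (n + 1) → Fin (n + 1) //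
    Monotone D ∧ D 0 = 0 ∧ ∑ i : Fin n, (D i.succ : ℕ) = n}

namespace DegreeSequence

/-- The underlying sequence of natural numbers. -/
def toNat (D : DegreeSequence n) (i : Fin (n + 1)) : ℕ := D.1 i

theorem monotone_toNat (D : DegreeSequence n) : Monotone D.toNat := fun _ _ h => D.2.1 h

theorem toNat_zero (D : DegreeSequence n) : D.toNat 0 = 0 := by
  simp [toNat, D.2.2.1]

/-- An enumeration of the positions in the blocks. -/
noncomputable def positions (D : DegreeSequence n) : (Σ i : Fin n, Fin (D.toNat i.succ)) ≃ Fin n :=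
  Fintype.equivFinOfCardEq (by
    rw [Fintype.card_sigma]
    exact (Finset.sum_congr rfl fun i _ => Fintype.card_fin _).trans D.2.2.2)

/-- The normal form with degree sequence `D` and coefficients `c`. -/
noncomputable def normalForm (D : DegreeSequence n) (c : ℕ → k) : Matrix (Fin n) (Fin n) k :=
  hessenbergBlocks (fun i => D.toNat i.succ) D.positions (blockArray D.toNat c)

/-- The invariant factors of `D.normalForm c`. -/
noncomputable def factor (D : DegreeSequence n) (c : ℕ → k) (i : Fin n) : k[X] :=
  hessenbergPoly (blockArray D.toNat c) (D.toNat i.succ)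

theorem factor_monic (D : DegreeSequence n) (c : ℕ → k) (i : Fin n) : (D.factor c i).Monic :=
  hessenbergPoly_monic _ _

theorem normalForm_isRepresentedBy (D : DegreeSequence n) (c : ℕ → k) :
    IsRepresentedBy (D.normalForm c) (D.factor c) :=
  hessenbergBlocks_isRepresentedBy _ _ _

theorem factor_dvd_factor (D : DegreeSequence n) (c : ℕ → k) (i j : Fin n) (hij : i ≤ j) :
    D.factor c i ∣ D.factor c j := by
  have key : ∀ j : Fin (n + 1), i.succ ≤ j →
      D.factor c i ∣ hessenbergPoly (blockArray D.toNat c) (D.toNat j) := by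
    intro j
    induction j using Fin.induction with
    | zero => intro h; simp at h
    | succ j ih =>
      intro h
      rcases h.eq_or_lt with h | h
      · rw [← h]
        exact dvd_rfl
      · rw [hessenbergPoly_block D.monotone_toNat]
        exact (ih (Fin.le_castSucc_iff.2 h)).mul_left _
  exact key j.succ (Fin.succ_le_succ_iff.2 hij)

theorem eq_of_factor_eq {D D' : DegreeSequence n} {c c' : ℕ → k} (h : D.factor c = D'.factor c') :
    D = D' ∧ D.normalForm c = D'.normalForm c' := by
  obtain rfl : D = D' := by
    refine Subtype.ext (funext (Fin.cases ?_ fun i => Fin.ext ?_))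
    · rw [D.2.2.1, D'.2.2.1]
    · have := congrArg natDegree (congrFun h i)
      rwa [factor, factor, natDegree_hessenbergPoly, natDegree_hessenbergPoly] at this
  refine ⟨rfl, ?_⟩
  rw [normalForm, normalForm, blockArray_eq_of_hessenbergPoly_eq D.monotone_toNat]
  refine Fin.cases ?_ fun i => congrFun h i
  rw [toNat_zero, hessenbergPoly_zero, hessenbergPoly_zero]

theorem exists_factor_eq (f : Fin n → k[X]) (hf : ∀ i, (f i).Monic)
    (hfc : ∀ i j, i ≤ j → f i ∣ f j) (hdeg : ∑ i, (f i).natDegree = n) :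
    ∃ (D : DegreeSequence n) (c : ℕ → k), D.factor c = f := by
  let F : Fin (n + 1) → k[X] := Fin.cons 1 f
  have hF : ∀ i, (F i).Monic := Fin.cases monic_one hf
  have hFc : ∀ i j, i ≤ j → F i ∣ F j := by
    refine Fin.cases (fun j _ => one_dvd _) fun i => Fin.cases ?_ ?_
    · intro h; simp at h
    · intro j h; exact hfc i j (Fin.succ_le_succ_iff.1 h)
  have hmono : Monotone fun i => (F i).natDegree := fun i j hij =>
    natDegree_le_of_dvd (hFc i j hij) (hF j).ne_zero
  have hle : ∀ i, (F i).natDegree < n + 1 := by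
    refine Fin.cases (by simp [F]) fun i => Nat.lt_succ_iff.2 ?_
    calc (f i).natDegree ≤ ∑ i, (f i).natDegree :=
          Finset.single_le_sum (f := fun i => (f i).natDegree) (fun _ _ => Nat.zero_le _)
            (Finset.mem_univ i)
      _ = n := hdeg
  obtain ⟨c, hc⟩ := exists_hessenbergPoly_eq F hF rfl
    (fun i => hFc _ _ (Fin.castSucc_lt_succ (i := i)).le) hmono
  refine ⟨⟨fun i => ⟨(F i).natDegree, hle i⟩, hmono, Fin.ext (by simp [F]), hdeg⟩, c, ?_⟩
  exact funext fun i => hc i.succ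

/-- The linear part of the affine map `c ↦ D.normalForm c`. -/
noncomputable def normalFormLinear (k : Type*) [Field k] (D : DegreeSequence n) :
    (ℕ → k) →ₗ[k] Matrix (Fin n) (Fin n) k where
  toFun c := D.normalForm c - D.normalForm 0
  map_add' c c' := by
    ext i j
    simp only [normalForm, hessenbergBlocks, Matrix.reindex_apply, Matrix.submatrix_apply,
      Matrix.sub_apply, Matrix.add_apply, Matrix.blockDiagonal'_apply, Matrix.of_apply,
      hessenbergEntry, blockArray, Pi.add_apply, Pi.zero_apply]
    split_ifs <;> simp [add_comm]
  map_smul' a c := by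
    ext i j
    simp only [normalForm, hessenbergBlocks, Matrix.reindex_apply, Matrix.submatrix_apply,
      Matrix.sub_apply, Matrix.smul_apply, Matrix.blockDiagonal'_apply, Matrix.of_apply,
      hessenbergEntry, blockArray, Pi.smul_apply, Pi.zero_apply, RingHom.id_apply]
    split_ifs <;> simp

theorem exists_mem_range_normalFormLinear_iff (D : DegreeSequence n)
    (M : Matrix (Fin n) (Fin n) k) :
    (∃ w ∈ LinearMap.range (D.normalFormLinear k), M = D.normalForm 0 + w) ↔
      ∃ c, M = D.normalForm c := by
  constructor
  · rintro ⟨_, ⟨c, rfl⟩, rfl⟩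
    exact ⟨c, by simp [normalFormLinear]⟩
  · rintro ⟨c, rfl⟩
    exact ⟨_, ⟨c, rfl⟩, by simp [normalFormLinear]⟩

end DegreeSequence

end NormalForm

/-- Over any field `k` and for `n ≥ 1`, there are finitely many pairwise
disjoint affine subspaces (cosets `v i + W i` of linear subspaces `W i`) of the space of
`n × n` matrices such that every matrix is similar to exactly one matrix in their union. -/
theorem stmt0 (k : Type*) [Field k] (n : ℕ) (hn : 1 ≤ n) :
    ∃ (N : ℕ) (v : Fin N → Matrix (Fin n) (Fin n) k)
      (W : Fin N → Submodule k (Matrix (Fin n) (Fin n) k)),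
      (Pairwise fun i j =>
        Disjoint {M | ∃ w ∈ W i, M = v i + w} {M | ∃ w ∈ W j, M = v j + w}) ∧
      ∀ A : Matrix (Fin n) (Fin n) k,
        ∃! B : Matrix (Fin n) (Fin n) k,
          (B ∈ ⋃ i, {M | ∃ w ∈ W i, M = v i + w}) ∧
          ∃ T : (Matrix (Fin n) (Fin n) k)ˣ,
            (↑T⁻¹ : Matrix (Fin n) (Fin n) k) * A * (↑T : Matrix (Fin n) (Fin n) k) = B := by
  classical
  have huniq : ∀ (A : Matrix (Fin n) (Fin n) k) (f g : Fin n → k[X]), (∀ i, (f i).Monic) →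
      (∀ i, (g i).Monic) → (∀ i j, i ≤ j → f i ∣ f j) → (∀ i j, i ≤ j → g i ∣ g j) →
      IsRepresentedBy A f → IsRepresentedBy A g → f = g := fun A f g hf hg hfc hgc hAf hAg =>
    eq_of_sum_smulRank_eq hf hg hfc hgc
      (hAf.sum_smulRank_eq (fun i => (hf i).ne_zero) (fun i => (hg i).ne_zero) hAg)
  let σ := (Fintype.equivFin (DegreeSequence n)).symm
  refine ⟨Fintype.card (DegreeSequence n), fun i => (σ i).normalForm 0,
    fun i => LinearMap.range ((σ i).normalFormLinear k), fun i j hij => ?_, fun A => ?_⟩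
  · refine Set.disjoint_left.2 ?_
    intro M hMi hMj
    obtain ⟨c, rfl⟩ := ((σ i).exists_mem_range_normalFormLinear_iff M).1 hMi
    obtain ⟨c', hc'⟩ := ((σ j).exists_mem_range_normalFormLinear_iff _).1 hMj
    have hrep := (σ j).normalForm_isRepresentedBy c'
    rw [← hc'] at hrep
    exact hij (σ.injective (DegreeSequence.eq_of_factor_eq (huniq _ _ _ ((σ i).factor_monic c)
      ((σ j).factor_monic c') ((σ i).factor_dvd_factor c) ((σ j).factor_dvd_factor c')
      ((σ i).normalForm_isRepresentedBy c) hrep)).1)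
  · have hmem : ∀ B : Matrix (Fin n) (Fin n) k,
        (B ∈ ⋃ i, {M | ∃ w ∈ LinearMap.range ((σ i).normalFormLinear k),
          M = (σ i).normalForm 0 + w}) ↔ ∃ (D : DegreeSequence n) (c : ℕ → k),
            B = D.normalForm c := by
      intro B
      simp only [Set.mem_iUnion, Set.mem_ofPred_eq,
        DegreeSequence.exists_mem_range_normalFormLinear_iff]
      exact σ.exists_congr_left.trans (by simp)
    simp only [hmem]
    obtain ⟨f, hf, hfc, hA⟩ := exists_isRepresentedBy_chain A
    obtain ⟨D, c, rfl⟩ := DegreeSequence.exists_factor_eq f hf hfc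
      (hA.sum_natDegree fun i => (hf i).ne_zero)
    refine ⟨D.normalForm c, ⟨⟨D, c, rfl⟩, hA.exists_conj (D.normalForm_isRepresentedBy c)⟩, ?_⟩
    rintro _ ⟨⟨D', c', rfl⟩, T, hT⟩
    have hrep := hA.conj T
    rw [hT] at hrep
    exact (DegreeSequence.eq_of_factor_eq (huniq _ _ _ (D'.factor_monic c') hf
      (D'.factor_dvd_factor c') hfc (D'.normalForm_isRepresentedBy c') hrep)).2
end

section
/- Let k be a field, let Q_1, …, Q_s be monic polynomials over k of degrees q_1, …, q_s ≥ 1, set m = q_1 + ⋯ + q_s and P = Q_1·Q_2⋯Q_s. Then the generalized companion matrix C(Q_1, …, Q_s) is similar over k to the companion matrix B(P) of the product P. -/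
open Finset in
/-- The block of position `i` among consecutive blocks of sizes `q 0, …, q (s-1)`:
the number of blocks completely contained in `{0, …, i}`. -/
def blockOf (q : ℕ → ℕ) (s i : ℕ) : ℕ :=
  ((Finset.range s).filter fun b => ∑ j ∈ Finset.range (b + 1), q j ≤ i).card

/-- The companion matrix of a monic polynomial `P` of degree `m` (as an `m × m` matrix,
0-indexed): entries `1` on the subdiagonal, `-(coeff i)` in the last column, `0` elsewhere. -/
def companionMatrix {k : Type*} [Field k] (m : ℕ) (P : Polynomial k) :
    Matrix (Fin m) (Fin m) k :=
  Matrix.of fun i j =>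
    if (j : ℕ) = m - 1 then -P.coeff i
    else if (i : ℕ) = (j : ℕ) + 1 then 1 else 0

/-- The generalized companion matrix `C(Q 0, …, Q (s-1))` of size `m = q 0 + ⋯ + q (s-1)`:
diagonal blocks are the companion matrices `B(Q b)` of sizes `q b`, all subdiagonal entries
(also those between consecutive blocks) are `1`, and all other entries are `0`. -/
def genCompanion {k : Type*} [Field k] (s : ℕ) (q : ℕ → ℕ) (Q : ℕ → Polynomial k)
    (m : ℕ) : Matrix (Fin m) (Fin m) k :=
  Matrix.of fun i j =>
    let bi := blockOf q s i
    let bj := blockOf q s j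
    let off := ∑ t ∈ Finset.range bj, q t
    if bi = bj ∧ (j : ℕ) = off + q bj - 1 then -(Q bj).coeff ((i : ℕ) - off)
    else if (i : ℕ) = (j : ℕ) + 1 then 1 else 0

open Polynomial

theorem blockOf_eq {q : ℕ → ℕ} {s b i : ℕ} (hb : b ≤ s)
    (hle : ∑ j ∈ Finset.range b, q j ≤ i)
    (hlt : b < s → i < ∑ j ∈ Finset.range (b + 1), q j) : blockOf q s i = b := by
  have hmono : Monotone fun b => ∑ j ∈ Finset.range b, q j := fun a c h =>
    Finset.sum_le_sum_of_subset (Finset.range_mono h)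
  have : (Finset.range s).filter (fun b => ∑ j ∈ Finset.range (b + 1), q j ≤ i)
      = Finset.range b := by
    ext c
    simp only [Finset.mem_filter, Finset.mem_range]
    constructor
    · rintro ⟨hc, h⟩
      by_contra! hbc
      have h1 := hlt (by omega)
      have h2 := hmono (show b + 1 ≤ c + 1 by omega)
      simp only at h2
      omega
    · intro hc
      exact ⟨by omega, (hmono (show c + 1 ≤ b by omega)).trans hle⟩
  rw [blockOf, this, Finset.card_range]

theorem exists_block {q : ℕ → ℕ} {s i : ℕ} (hi : i < ∑ j ∈ Finset.range s, q j) :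
    ∃ b < s, ∃ t < q b, i = ∑ j ∈ Finset.range b, q j + t := by
  induction s with
  | zero => simp at hi
  | succ s ih =>
    by_cases h : i < ∑ j ∈ Finset.range s, q j
    · obtain ⟨b, hb, ht⟩ := ih h
      exact ⟨b, by omega, ht⟩
    · rw [Finset.sum_range_succ] at hi
      exact ⟨s, by omega, i - ∑ j ∈ Finset.range s, q j, by omega, by omega⟩

theorem blockOf_eq_iff {q : ℕ → ℕ} {s b i : ℕ} (hb : b < s)
    (hi : i < ∑ j ∈ Finset.range s, q j) :
    blockOf q s i = b ↔
      ∑ j ∈ Finset.range b, q j ≤ i ∧ i < ∑ j ∈ Finset.range b, q j + q b := by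
  constructor
  · intro h
    obtain ⟨c, hc, t, ht, rfl⟩ := exists_block hi
    rw [blockOf_eq hc.le (by omega) (by rw [Finset.sum_range_succ]; omega)] at h
    subst h
    omega
  · rintro ⟨h1, h2⟩
    exact blockOf_eq hb.le h1 (by rw [Finset.sum_range_succ]; omega)

/-- The polynomial `Q 0 ⋯ Q (b-1) * X ^ t` attached to the position `i = q 0 + ⋯ + q (b-1) + t`
of block `b`. -/
noncomputable def blockBasis {k : Type*} [Field k] (s : ℕ) (q : ℕ → ℕ) (Q : ℕ → k[X])
    (i : ℕ) : k[X] :=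
  (∏ j ∈ Finset.range (blockOf q s i), Q j) *
    X ^ (i - ∑ j ∈ Finset.range (blockOf q s i), q j)

section

variable {k : Type*} [Field k] {s : ℕ} {q : ℕ → ℕ} {Q : ℕ → k[X]}

theorem blockBasis_add {b t : ℕ} (hb : b < s) (ht : t < q b) :
    blockBasis s q Q (∑ j ∈ Finset.range b, q j + t) = (∏ j ∈ Finset.range b, Q j) * X ^ t := by
  rw [blockBasis, blockOf_eq hb.le (by omega) (by rw [Finset.sum_range_succ]; omega),
    Nat.add_sub_cancel_left]

theorem blockBasis_sum (hq : ∀ j < s, 1 ≤ q j) {b : ℕ} (hb : b ≤ s) :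
    blockBasis s q Q (∑ j ∈ Finset.range b, q j) = ∏ j ∈ Finset.range b, Q j := by
  rw [blockBasis, blockOf_eq hb le_rfl, Nat.sub_self, pow_zero, mul_one]
  intro h
  rw [Finset.sum_range_succ]
  have := hq b h
  omega

theorem blockBasis_monic (hQmonic : ∀ j < s, (Q j).Monic) {i : ℕ}
    (hi : i < ∑ j ∈ Finset.range s, q j) : (blockBasis s q Q i).Monic := by
  obtain ⟨b, hb, t, ht, rfl⟩ := exists_block hi
  rw [blockBasis_add hb ht]
  refine (monic_prod_of_monic _ _ fun j hj => hQmonic j ?_).mul (monic_X_pow t)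
  rw [Finset.mem_range] at hj
  omega

theorem blockBasis_natDegree (hQmonic : ∀ j < s, (Q j).Monic)
    (hQdeg : ∀ j < s, (Q j).natDegree = q j) {i : ℕ}
    (hi : i < ∑ j ∈ Finset.range s, q j) : (blockBasis s q Q i).natDegree = i := by
  obtain ⟨b, hb, t, ht, rfl⟩ := exists_block hi
  have hlt : ∀ j ∈ Finset.range b, j < s := fun j hj => by
    rw [Finset.mem_range] at hj; omega
  have hmon : ∀ j ∈ Finset.range b, (Q j).Monic := fun j hj => hQmonic j (hlt j hj)
  rw [blockBasis_add hb ht, (monic_prod_of_monic _ _ hmon).natDegree_mul (monic_X_pow t),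
    natDegree_prod_of_monic _ _ hmon, natDegree_X_pow,
    Finset.sum_congr rfl fun j hj => hQdeg j (hlt j hj)]

/-- Multiplication by `X` on the polynomials `blockBasis s q Q i`. -/
theorem X_mul_blockBasis (hq : ∀ j < s, 1 ≤ q j) (hQmonic : ∀ j < s, (Q j).Monic)
    (hQdeg : ∀ j < s, (Q j).natDegree = q j) {b t : ℕ} (hb : b < s) (ht : t < q b) :
    X * blockBasis s q Q (∑ j ∈ Finset.range b, q j + t) =
      blockBasis s q Q (∑ j ∈ Finset.range b, q j + t + 1) +
      if t + 1 = q b then ∑ u ∈ Finset.range (q b),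
        C (-(Q b).coeff u) * blockBasis s q Q (∑ j ∈ Finset.range b, q j + u) else 0 := by
  rw [blockBasis_add hb ht]
  split_ifs with h
  · have hQ : Q b = X ^ q b + ∑ u ∈ Finset.range (q b), C ((Q b).coeff u) * X ^ u := by
      conv_lhs => rw [(hQmonic b hb).as_sum, hQdeg b hb]
    have hsum : ∑ u ∈ Finset.range (q b),
        C (-(Q b).coeff u) * blockBasis s q Q (∑ j ∈ Finset.range b, q j + u) =
        -((∏ j ∈ Finset.range b, Q j) * ∑ u ∈ Finset.range (q b), C ((Q b).coeff u) * X ^ u) := by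
      rw [Finset.mul_sum, ← Finset.sum_neg_distrib]
      refine Finset.sum_congr rfl fun u hu => ?_
      rw [blockBasis_add hb (Finset.mem_range.mp hu), C_neg]
      ring
    rw [hsum, add_assoc, h, ← Finset.sum_range_succ, blockBasis_sum hq hb,
      Finset.prod_range_succ]
    have hX : (X : k[X]) ^ q b = X ^ t * X := by rw [← h, pow_succ]
    rw [hX] at hQ
    linear_combination (-∏ j ∈ Finset.range b, Q j) * hQ
  · rw [add_assoc, blockBasis_add hb (by omega)]
    ring

theorem genCompanion_apply {m : ℕ} (hm : m = ∑ j ∈ Finset.range s, q j)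
    {b t : ℕ} (hb : b < s) (ht : t < q b) (i j : Fin m)
    (hj : (j : ℕ) = ∑ j ∈ Finset.range b, q j + t) :
    genCompanion s q Q m i j =
      (if t + 1 = q b then if (i : ℕ) ∈ Finset.Ico (∑ j ∈ Finset.range b, q j)
          (∑ j ∈ Finset.range b, q j + q b)
        then -(Q b).coeff (i - ∑ j ∈ Finset.range b, q j) else 0 else 0) +
      if (i : ℕ) = j + 1 then 1 else 0 := by
  have hbj : blockOf q s j = b :=
    blockOf_eq hb.le (by omega) (by rw [Finset.sum_range_succ]; omega)
  have hbi := blockOf_eq_iff hb (i.isLt.trans_eq hm)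
  have hend : (j : ℕ) = ∑ j ∈ Finset.range b, q j + q b - 1 ↔ t + 1 = q b := by omega
  simp only [genCompanion, Matrix.of_apply, hbj, hbi, hend, Finset.mem_Ico]
  split_ifs <;> first | omega | simp

/-- The columns of the generalized companion matrix give multiplication by `X` modulo the
product of the `Q j`. -/
theorem sum_genCompanion_mul_blockBasis (hq : ∀ j < s, 1 ≤ q j)
    (hQmonic : ∀ j < s, (Q j).Monic) (hQdeg : ∀ j < s, (Q j).natDegree = q j)
    {m : ℕ} (hm : m = ∑ j ∈ Finset.range s, q j) (j : Fin m) :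
    ∑ i : Fin m, C (genCompanion s q Q m i j) * blockBasis s q Q i =
      X * blockBasis s q Q j -
        if (j : ℕ) + 1 = m then ∏ j ∈ Finset.range s, Q j else 0 := by
  obtain ⟨b, hb, t, ht, hj⟩ := exists_block (j.isLt.trans_eq hm)
  have hle : ∑ j ∈ Finset.range b, q j + q b ≤ m := by
    rw [hm, ← Finset.sum_range_succ]
    exact Finset.sum_le_sum_of_subset (Finset.range_mono hb)
  have hshift : ∑ i : Fin m, C (if (i : ℕ) = j + 1 then (1 : k) else 0) * blockBasis s q Q i =
      blockBasis s q Q (j + 1) - if (j : ℕ) + 1 = m then ∏ j ∈ Finset.range s, Q j else 0 := by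
    rw [Fin.sum_univ_eq_sum_range
      (fun i => C (if i = (j : ℕ) + 1 then (1 : k) else 0) * blockBasis s q Q i) m]
    have hjm := j.isLt
    split_ifs with h
    · rw [h, ← blockBasis_sum hq le_rfl, ← hm, sub_self]
      refine Finset.sum_eq_zero fun i hi => ?_
      rw [if_neg (Finset.mem_range.mp hi).ne, C_0, zero_mul]
    · rw [Finset.sum_eq_single_of_mem ((j : ℕ) + 1) (Finset.mem_range.mpr (by omega))]
      · simp
      · intro i _ hi
        rw [if_neg hi, C_0, zero_mul]
  simp_rw [genCompanion_apply hm hb ht _ j hj, C_add, add_mul, Finset.sum_add_distrib]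
  have hX := X_mul_blockBasis hq hQmonic hQdeg hb ht
  rw [← hj] at hX
  rw [hshift, hX, add_comm, add_sub_right_comm]
  congr 1
  split_ifs
  · rw [Fin.sum_univ_eq_sum_range (fun i => C (if i ∈ Finset.Ico (∑ j ∈ Finset.range b, q j)
      (∑ j ∈ Finset.range b, q j + q b) then -(Q b).coeff (i - ∑ j ∈ Finset.range b, q j) else 0)
      * blockBasis s q Q i) m]
    simp_rw [apply_ite C, ite_mul, C_0, zero_mul]
    rw [← Finset.sum_filter, Finset.filter_mem_eq_inter, Finset.inter_eq_right.mpr,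
      Finset.sum_Ico_eq_sum_range, Nat.add_sub_cancel_left]
    · simp_rw [Nat.add_sub_cancel_left]
    · intro i hi
      simp only [Finset.mem_Ico, Finset.mem_range] at hi ⊢
      omega
  · simp

/-- The companion matrix of `P` acts on coefficient vectors as multiplication by `X`
modulo `P`. -/
theorem sum_companionMatrix_mul_coeff {m : ℕ} (P f : k[X]) (i : Fin m) :
    ∑ l : Fin m, companionMatrix m P i l * f.coeff l =
      (X * f).coeff i - f.coeff (m - 1) * P.coeff i := by
  have him := i.isLt
  have hsum : ∀ l : ℕ, (if l = m - 1 then -P.coeff i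
      else if (i : ℕ) = l + 1 then 1 else 0) * f.coeff l =
      (if (i : ℕ) = l + 1 then f.coeff l else 0) -
        if l = m - 1 then f.coeff (m - 1) * P.coeff i else 0 := by
    intro l
    split_ifs with h h' h'
    · omega
    · rw [h]; ring
    · simp
    · simp
  simp only [companionMatrix, Matrix.of_apply]
  rw [Fin.sum_univ_eq_sum_range (fun l => (if l = m - 1 then -P.coeff i
    else if (i : ℕ) = l + 1 then 1 else 0) * f.coeff l) m]
  simp_rw [hsum, Finset.sum_sub_distrib]
  rw [Finset.sum_ite_eq' (Finset.range m) (m - 1), if_pos (Finset.mem_range.mpr (by omega))]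
  congr 1
  rcases hi : (i : ℕ) with _ | n
  · simp
  · rw [coeff_X_mul]
    simp only [add_left_inj]
    rw [Finset.sum_ite_eq, if_pos (Finset.mem_range.mpr (by omega))]

end

/-- the generalized companion matrix `C(Q 0, …, Q (s-1))` is similar over `k`
to the companion matrix of the product `P = Q 0 · Q 1 ⋯ Q (s-1)`. -/
theorem stmt1 {k : Type*} [Field k] (s : ℕ) (hs : 1 ≤ s)
    (q : ℕ → ℕ) (hq : ∀ j < s, 1 ≤ q j)
    (Q : ℕ → Polynomial k) (hQmonic : ∀ j < s, (Q j).Monic)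
    (hQdeg : ∀ j < s, (Q j).natDegree = q j)
    (m : ℕ) (hm : m = ∑ j ∈ Finset.range s, q j)
    (P : Polynomial k) (hP : P = ∏ j ∈ Finset.range s, Q j) :
    ∃ T : (Matrix (Fin m) (Fin m) k)ˣ,
      (↑T⁻¹ : Matrix (Fin m) (Fin m) k) * genCompanion s q Q m *
        (↑T : Matrix (Fin m) (Fin m) k) = companionMatrix m P := by
  have hmonic : ∀ i : Fin m, (blockBasis s q Q i).Monic := fun i =>
    blockBasis_monic hQmonic (i.isLt.trans_eq hm)
  have hdeg : ∀ i : Fin m, (blockBasis s q Q i).natDegree = i := fun i =>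
    blockBasis_natDegree hQmonic hQdeg (i.isLt.trans_eq hm)
  let W : Matrix (Fin m) (Fin m) k := Matrix.of fun i j => (blockBasis s q Q j).coeff i
  have hdet : W.det = 1 := by
    rw [Matrix.det_of_isUpperTriangular]
    · refine Finset.prod_eq_one fun i _ => ?_
      have := (hmonic i).coeff_natDegree
      rwa [hdeg i] at this
    · intro i j hij
      exact coeff_eq_zero_of_natDegree_lt ((hdeg j).trans_lt hij)
  have hW : companionMatrix m P * W = W * genCompanion s q Q m := by
    ext i j
    have hcol := congrArg (fun p => p.coeff (i : ℕ))
      (sum_genCompanion_mul_blockBasis hq hQmonic hQdeg hm j)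
    simp only [finsetSum_coeff, coeff_C_mul, coeff_sub] at hcol
    have hrow := sum_companionMatrix_mul_coeff P (blockBasis s q Q j) i
    have hlast : (blockBasis s q Q j).coeff (m - 1) = if (j : ℕ) + 1 = m then 1 else 0 := by
      have hjm := j.isLt
      split_ifs with h
      · rw [show m - 1 = (blockBasis s q Q j).natDegree by rw [hdeg j]; omega]
        exact hmonic j
      · exact coeff_eq_zero_of_natDegree_lt (by rw [hdeg j]; omega)
    simp only [Matrix.mul_apply, W, Matrix.of_apply]
    rw [hrow, hlast]
    simp_rw [mul_comm (coeff _ _)]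
    rw [hcol, ← hP]
    split_ifs <;> simp
  obtain ⟨U, hU⟩ : IsUnit W := by
    rw [Matrix.isUnit_iff_isUnit_det, hdet]
    exact isUnit_one
  refine ⟨U⁻¹, ?_⟩
  rw [inv_inv, hU, ← hW, mul_assoc, ← hU, Units.mul_inv, mul_one]
end

section
/- Let k be a field, Q_1, …, Q_s monic polynomials over k of degrees q_1, …, q_s ≥ 1, m = q_1 + ⋯ + q_s, P = Q_1·Q_2⋯Q_s, and let C = C(Q_1, …, Q_s) be the generalized companion matrix acting on k^m. Then the first standard basis vector e_1 is a cyclic vector for C, i.e. the k-linear span of {C^j e_1 : j ∈ ℕ} is all of k^m, and moreover P(C)·e_1 = 0, where P(C) denotes the evaluation of the polynomial P at the matrix C. -/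
theorem blockOf_sum_add {q : ℕ → ℕ} {s b r : ℕ} (hb : b < s) (hr : r < q b) :
    blockOf q s (∑ t ∈ Finset.range b, q t + r) = b := by
  have mono : Monotone fun n => ∑ t ∈ Finset.range n, q t := fun a c h =>
    Finset.sum_le_sum_of_subset (Finset.range_mono h)
  have filter_eq : ((Finset.range s).filter fun c =>
      ∑ j ∈ Finset.range (c + 1), q j ≤ ∑ t ∈ Finset.range b, q t + r) = Finset.range b := by
    ext c
    simp only [Finset.mem_filter, Finset.mem_range]
    constructor
    · rintro ⟨-, h⟩
      by_contra! hbc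
      have h' : ∑ t ∈ Finset.range (b + 1), q t ≤ ∑ t ∈ Finset.range (c + 1), q t :=
        mono (Nat.succ_le_succ hbc)
      rw [Finset.sum_range_succ _ b] at h'
      omega
    · intro h
      have h' : ∑ t ∈ Finset.range (c + 1), q t ≤ ∑ t ∈ Finset.range b, q t :=
        mono (Nat.succ_le_of_lt h)
      exact ⟨h.trans hb, by omega⟩
  rw [blockOf, filter_eq, Finset.card_range]

theorem exists_eq_sum_range_add_of_lt {q : ℕ → ℕ} {s i : ℕ}
    (hi : i < ∑ t ∈ Finset.range s, q t) :
    ∃ b < s, ∃ r < q b, i = ∑ t ∈ Finset.range b, q t + r := by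
  induction s with
  | zero => simp at hi
  | succ s ih =>
    by_cases h : i < ∑ t ∈ Finset.range s, q t
    · obtain ⟨b, hb, hr⟩ := ih h
      exact ⟨b, hb.trans s.lt_succ_self, hr⟩
    · rw [Finset.sum_range_succ] at hi
      exact ⟨s, s.lt_succ_self, i - ∑ t ∈ Finset.range s, q t, by omega, by omega⟩

/-- The `n`-th standard basis vector (0-indexed) of `k^m`, extended by `0` to `n ≥ m`. -/
def stdVec (k : Type*) [Field k] (m n : ℕ) : Fin m → k :=
  fun i => if (i : ℕ) = n then 1 else 0

section GenCompanion

open Matrix Polynomial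

variable {k : Type*} [Field k]

theorem mulVec_stdVec {m n : ℕ} (A : Matrix (Fin m) (Fin m) k) (hn : n < m) :
    A *ᵥ stdVec k m n = fun i => A i ⟨n, hn⟩ := by
  ext i
  have h (j : Fin m) : ((j : ℕ) = n) = (j = ⟨n, hn⟩) := by simp [Fin.ext_iff]
  simp [mulVec, dotProduct, stdVec, h]

variable {s : ℕ} {q : ℕ → ℕ} {b r : ℕ}

theorem sum_range_add_lt (hb : b < s) (hr : r < q b) :
    ∑ t ∈ Finset.range b, q t + r < ∑ t ∈ Finset.range s, q t := by
  have h : ∑ t ∈ Finset.range (b + 1), q t ≤ ∑ t ∈ Finset.range s, q t :=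
    Finset.sum_le_sum_of_subset (Finset.range_mono hb)
  rw [Finset.sum_range_succ] at h
  omega

theorem genCompanion_mulVec_stdVec (Q : ℕ → k[X]) (hb : b < s) (hr : r + 1 < q b) :
    genCompanion s q Q (∑ t ∈ Finset.range s, q t) *ᵥ
      stdVec k _ (∑ t ∈ Finset.range b, q t + r) =
      stdVec k _ (∑ t ∈ Finset.range b, q t + (r + 1)) := by
  rw [mulVec_stdVec _ (sum_range_add_lt hb (by omega))]
  ext i
  have h : ¬ (∑ t ∈ Finset.range b, q t + r = ∑ t ∈ Finset.range b, q t + q b - 1) := by omega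
  simp [genCompanion, stdVec, blockOf_sum_add hb (show r < q b by omega), h, add_assoc]

theorem genCompanion_mulVec_stdVec_last (Q : ℕ → k[X]) (hb : b < s) (hr : r + 1 = q b) :
    genCompanion s q Q (∑ t ∈ Finset.range s, q t) *ᵥ
      stdVec k _ (∑ t ∈ Finset.range b, q t + r) =
      stdVec k _ (∑ t ∈ Finset.range (b + 1), q t) -
        ∑ t ∈ Finset.range (q b), (Q b).coeff t • stdVec k _ (∑ t ∈ Finset.range b, q t + t) := by
  rw [mulVec_stdVec _ (sum_range_add_lt hb (by omega))]
  ext i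
  have h : ∑ t ∈ Finset.range b, q t + r = ∑ t ∈ Finset.range b, q t + q b - 1 := by omega
  have hsucc : ∑ t ∈ Finset.range b, q t + r + 1 = ∑ t ∈ Finset.range (b + 1), q t := by
    rw [Finset.sum_range_succ]
    omega
  simp only [genCompanion, of_apply, blockOf_sum_add hb (show r < q b by omega), h.symm, and_true,
    hsucc, Pi.sub_apply, Finset.sum_apply, Pi.smul_apply, smul_eq_mul, stdVec, mul_ite, mul_one,
    mul_zero]
  obtain ⟨c, hc, u, hu, hi⟩ := exists_eq_sum_range_add_of_lt i.2
  have hblock := blockOf_sum_add hc hu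
  rw [← hi] at hblock
  rw [hblock]
  split_ifs with hcb hlast hlast
  · subst hcb
    omega
  · subst hcb
    simp [hi, hu]
  all_goals
    rw [Finset.sum_eq_zero, sub_zero]
    intro t ht
    rw [if_neg]
    intro hit
    exact hcb (by rw [← hblock, hit, blockOf_sum_add hb (Finset.mem_range.mp ht)])

theorem genCompanion_pow_mulVec_stdVec (Q : ℕ → k[X]) (hb : b < s) (hr : r < q b) :
    genCompanion s q Q (∑ t ∈ Finset.range s, q t) ^ r *ᵥ
      stdVec k _ (∑ t ∈ Finset.range b, q t) =
      stdVec k _ (∑ t ∈ Finset.range b, q t + r) := by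
  induction r with
  | zero => simp
  | succ r ih =>
    rw [pow_succ', ← mulVec_mulVec, ih (by omega), genCompanion_mulVec_stdVec Q hb hr]

theorem aeval_genCompanion_mulVec_stdVec {Q : ℕ → k[X]} (hb : b < s) (hq : 1 ≤ q b)
    (hmonic : (Q b).Monic) (hdeg : (Q b).natDegree = q b) :
    aeval (genCompanion s q Q (∑ t ∈ Finset.range s, q t)) (Q b) *ᵥ
      stdVec k _ (∑ t ∈ Finset.range b, q t) =
      stdVec k _ (∑ t ∈ Finset.range (b + 1), q t) := by
  obtain ⟨r, hr⟩ := Nat.exists_eq_add_of_le' hq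
  have hlead : (Q b).coeff (q b) = 1 := hdeg ▸ hmonic.coeff_natDegree
  have hpow : genCompanion s q Q (∑ t ∈ Finset.range s, q t) ^ q b *ᵥ
      stdVec k _ (∑ t ∈ Finset.range b, q t) =
      stdVec k _ (∑ t ∈ Finset.range (b + 1), q t) -
        ∑ t ∈ Finset.range (q b), (Q b).coeff t • stdVec k _ (∑ t ∈ Finset.range b, q t + t) := by
    rw [← genCompanion_mulVec_stdVec_last Q hb hr.symm,
      ← genCompanion_pow_mulVec_stdVec Q hb (by omega), mulVec_mulVec, ← pow_succ', hr]
  rw [aeval_eq_sum_range, hdeg, Finset.sum_range_succ, hlead, one_smul, add_mulVec, hpow,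
    sum_mulVec, add_comm, sub_add_eq_add_sub, add_sub_assoc, sub_eq_zero.mpr, add_zero]
  refine Finset.sum_congr rfl fun t ht => ?_
  rw [smul_mulVec, genCompanion_pow_mulVec_stdVec Q hb (Finset.mem_range.mp ht)]

theorem aeval_genCompanion_prod_mulVec_stdVec {Q : ℕ → k[X]} (hq : ∀ j < s, 1 ≤ q j)
    (hmonic : ∀ j < s, (Q j).Monic) (hdeg : ∀ j < s, (Q j).natDegree = q j) (hb : b ≤ s) :
    aeval (genCompanion s q Q (∑ t ∈ Finset.range s, q t)) (∏ j ∈ Finset.range b, Q j) *ᵥ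
      stdVec k _ 0 = stdVec k _ (∑ t ∈ Finset.range b, q t) := by
  induction b with
  | zero => simp
  | succ b ih =>
    rw [Finset.prod_range_succ, mul_comm, map_mul, ← mulVec_mulVec, ih (by omega),
      aeval_genCompanion_mulVec_stdVec hb (hq b hb) (hmonic b hb) (hdeg b hb)]

theorem aeval_mulVec_mem_span_pow_mulVec {m : ℕ} (A : Matrix (Fin m) (Fin m) k) (p : k[X])
    (v : Fin m → k) :
    aeval A p *ᵥ v ∈ Submodule.span k {w : Fin m → k | ∃ j : ℕ, w = A ^ j *ᵥ v} := by
  rw [aeval_eq_sum_range, sum_mulVec]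
  refine Submodule.sum_mem _ fun j _ => ?_
  rw [smul_mulVec]
  exact Submodule.smul_mem _ _ (Submodule.subset_span ⟨j, rfl⟩)

end GenCompanion

open Matrix in
/-- for the generalized companion matrix `C = C(Q 0, …, Q (s-1))` acting on
`k^m`, the first standard basis vector `e₁` is a cyclic vector (the span of the iterates
`C^j e₁` is all of `k^m`), and `P(C) e₁ = 0` for `P = Q 0 · Q 1 ⋯ Q (s-1)`. -/
theorem stmt2 {k : Type*} [Field k] (s : ℕ) (hs : 1 ≤ s)
    (q : ℕ → ℕ) (hq : ∀ j < s, 1 ≤ q j)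
    (Q : ℕ → Polynomial k) (hQmonic : ∀ j < s, (Q j).Monic)
    (hQdeg : ∀ j < s, (Q j).natDegree = q j)
    (m : ℕ) (hm : m = ∑ j ∈ Finset.range s, q j)
    (P : Polynomial k) (hP : P = ∏ j ∈ Finset.range s, Q j)
    (e₁ : Fin m → k) (he₁ : e₁ = fun i : Fin m => if (i : ℕ) = 0 then (1 : k) else 0) :
    Submodule.span k {v : Fin m → k | ∃ j : ℕ, v = (genCompanion s q Q m ^ j) *ᵥ e₁} = ⊤ ∧
    (Polynomial.aeval (genCompanion s q Q m) P) *ᵥ e₁ = 0 := by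
  subst hm hP
  change e₁ = stdVec k _ 0 at he₁
  subst he₁
  have hprod {b : ℕ} (hb : b ≤ s) := aeval_genCompanion_prod_mulVec_stdVec hq hQmonic hQdeg hb
  constructor
  · rw [eq_top_iff]
    intro v _
    have hv : v = ∑ i, v i • stdVec k _ (i : ℕ) := by
      ext i
      simp [stdVec, Fin.val_inj]
    rw [hv]
    refine Submodule.sum_mem _ fun i _ => Submodule.smul_mem _ _ ?_
    obtain ⟨b, hb, r, hr, hi⟩ := exists_eq_sum_range_add_of_lt i.2
    rw [hi, ← genCompanion_pow_mulVec_stdVec Q hb hr, ← hprod hb.le, mulVec_mulVec,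
      ← Polynomial.aeval_X_pow (R := k), ← map_mul]
    exact aeval_mulVec_mem_span_pow_mulVec _ _ _
  · rw [hprod le_rfl]
    ext i
    simp [stdVec, i.2.ne]
end

section
/- Let k be a field and A ∈ k^{n×n}. Then there exist a unique integer r ≥ 1 and unique monic polynomials P_1, …, P_r over k, each of degree ≥ 1, with P_{i+1} dividing P_i for 1 ≤ i ≤ r−1, such that A is similar over k to the block-diagonal matrix R(P_1, …, P_r) with diagonal blocks the companion matrices B(P_1), …, B(P_r). -/
/-- The rational normal form `R(P 0, …, P (r-1))`: the block diagonal matrix whose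
diagonal blocks are the companion matrices `B(P b)` of sizes `p b`, all other entries `0`. -/
def ratNormalForm {k : Type*} [Field k] (r : ℕ) (p : ℕ → ℕ) (P : ℕ → Polynomial k)
    (n : ℕ) : Matrix (Fin n) (Fin n) k :=
  Matrix.of fun i j =>
    let bi := blockOf p r i
    let bj := blockOf p r j
    let off := ∑ t ∈ Finset.range bj, p t
    if bi = bj then
      (if (j : ℕ) = off + p bj - 1 then -(P bj).coeff ((i : ℕ) - off)
       else if (i : ℕ) = (j : ℕ) + 1 then 1 else 0)
    else 0

section RationalNormalForm

open Polynomial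

section CyclicModules

variable {R : Type*} [CommRing R]

/-- Multiplication by `c` as a map `R / (x) → R / (y)`. -/
def quotSpanMul {x y : R} (c : R) (h : y ∣ c * x) :
    (R ⧸ Ideal.span {x}) →ₗ[R] (R ⧸ Ideal.span {y}) :=
  Submodule.mapQ _ _ (LinearMap.lsmul R R c) <| by
    rw [Ideal.span, Submodule.span_le, Set.singleton_subset_iff]
    simpa [Ideal.mem_span_singleton] using h

lemma quotSpanMul_mk {x y : R} (c : R) (h : y ∣ c * x) (z : R) :
    quotSpanMul c h (Submodule.Quotient.mk z) = Submodule.Quotient.mk (c * z) := rfl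

/-- `R / (d a) × R / (d b) ≃ R / (d a b) × R / (d)` when `u a + v b = 1`. -/
def quotSpanProdEquiv (d a b u v : R) (h : u * a + v * b = 1) :
    ((R ⧸ Ideal.span {d * a}) × (R ⧸ Ideal.span {d * b})) ≃ₗ[R]
      ((R ⧸ Ideal.span {d * a * b}) × (R ⧸ Ideal.span {d})) :=
  LinearEquiv.ofLinearMap
    (LinearMap.prod
      (LinearMap.coprod (quotSpanMul (-(v * b)) ⟨-v, by ring⟩) (quotSpanMul (u * a) ⟨u, by ring⟩))
      (LinearMap.coprod (quotSpanMul 1 ⟨a, by ring⟩) (quotSpanMul 1 ⟨b, by ring⟩)))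
    (LinearMap.prod
      (LinearMap.coprod (quotSpanMul (-1) ⟨-b, by ring⟩) (quotSpanMul (u * a) ⟨u, by ring⟩))
      (LinearMap.coprod (quotSpanMul 1 ⟨a, by ring⟩) (quotSpanMul (v * b) ⟨v, by ring⟩)))
    (by
      apply LinearMap.ext
      rintro ⟨x, y⟩
      induction x using Submodule.Quotient.induction_on
      induction y using Submodule.Quotient.induction_on
      rename_i x y
      simp only [LinearMap.comp_apply, LinearMap.prod_apply, Function.prod_apply,
        LinearMap.coprod_apply, quotSpanMul_mk, ← Submodule.Quotient.mk_add, LinearMap.id_apply]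
      refine Prod.ext (congrArg Submodule.Quotient.mk ?_) (congrArg Submodule.Quotient.mk ?_)
      · linear_combination x * h
      · linear_combination y * h)
    (by
      apply LinearMap.ext
      rintro ⟨x, y⟩
      induction x using Submodule.Quotient.induction_on
      induction y using Submodule.Quotient.induction_on
      rename_i x y
      simp only [LinearMap.comp_apply, LinearMap.prod_apply, Function.prod_apply,
        LinearMap.coprod_apply, quotSpanMul_mk, ← Submodule.Quotient.mk_add, LinearMap.id_apply]
      refine Prod.ext (congrArg Submodule.Quotient.mk ?_) (congrArg Submodule.Quotient.mk ?_)
      · linear_combination x * h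
      · linear_combination y * h)

lemma exists_gcd_lcm_quotSpan_equiv [IsDomain R] [IsPrincipalIdealRing R] {a b : R} (ha : a ≠ 0)
    (hb : b ≠ 0) :
    ∃ d l : R, d ≠ 0 ∧ l ≠ 0 ∧ d ∣ a ∧ d ∣ b ∧ b ∣ l ∧ (∀ c, a ∣ c → b ∣ c → l ∣ c) ∧
      Nonempty (((R ⧸ Ideal.span {a}) × (R ⧸ Ideal.span {b})) ≃ₗ[R]
        ((R ⧸ Ideal.span {l}) × (R ⧸ Ideal.span {d}))) := by
  obtain ⟨d, hd⟩ := (IsPrincipalIdealRing.principal (Ideal.span {a, b})).principal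
  have hda : a ∈ Ideal.span {d} := hd.le (Ideal.subset_span (by simp))
  have hdb : b ∈ Ideal.span {d} := hd.le (Ideal.subset_span (by simp))
  have hdd : d ∈ Ideal.span {a, b} := hd.ge (Ideal.subset_span (by simp))
  obtain ⟨a, rfl⟩ := Ideal.mem_span_singleton.1 hda
  obtain ⟨b, rfl⟩ := Ideal.mem_span_singleton.1 hdb
  obtain ⟨u, v, huv⟩ := Ideal.mem_span_pair.1 hdd
  have hd0 : d ≠ 0 := left_ne_zero_of_mul ha
  have h : u * a + v * b = 1 := mul_left_cancel₀ hd0 (by linear_combination huv)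
  refine ⟨d, d * a * b, hd0, mul_ne_zero ha (right_ne_zero_of_mul hb), ⟨a, rfl⟩, ⟨b, rfl⟩,
    ⟨a, by ring⟩, ?_, ⟨quotSpanProdEquiv d a b u v h⟩⟩
  rintro c ⟨s, hs⟩ ⟨t, ht⟩
  exact ⟨u * t + v * s, by linear_combination -c * h + u * a * ht + v * b * hs⟩

end CyclicModules

variable {k : Type*} [Field k]

/-- The direct sum of the cyclic modules `k[X] / (P)` for `P` in a list. -/
abbrev CyclicSum (L : List k[X]) : Type _ := ∀ i : Fin L.length, k[X] ⧸ Ideal.span {L.get i}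

/-- Splitting off the first summand of a direct sum of cyclic modules. -/
noncomputable def cyclicSumCons (a : k[X]) (L : List k[X]) :
    ((k[X] ⧸ Ideal.span {a}) × CyclicSum L) ≃ₗ[k[X]] CyclicSum (a :: L) :=
  Fin.consLinearEquiv k[X] (fun i : Fin (L.length + 1) => k[X] ⧸ Ideal.span {(a :: L).get i})

/-- A list of nonconstant monic polynomials, each dividing its predecessors. -/
structure IsInvariantFactors (L : List k[X]) : Prop where
  monic : ∀ P ∈ L, P.Monic
  not_isUnit : ∀ P ∈ L, ¬ IsUnit P
  pairwise : L.Pairwise fun P Q => Q ∣ P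

lemma exists_monic_quotSpan_equiv {a : k[X]} (ha : a ≠ 0) :
    ∃ b : k[X], b.Monic ∧ Associated b a ∧
      Nonempty ((k[X] ⧸ Ideal.span {a}) ≃ₗ[k[X]] (k[X] ⧸ Ideal.span {b})) := by
  classical
  exact ⟨normalize a, monic_normalize ha, normalize_associated a,
    ⟨Submodule.quotEquivOfEq _ _
      (Ideal.span_singleton_eq_span_singleton.2 (normalize_associated a).symm)⟩⟩

lemma exists_isInvariantFactors_insert (L : List k[X]) (hL : IsInvariantFactors L) :
    ∀ a : k[X], a ≠ 0 → ∃ L', IsInvariantFactors L' ∧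
      (∀ c, a ∣ c → (∀ P ∈ L, P ∣ c) → ∀ P ∈ L', P ∣ c) ∧
      Nonempty (((k[X] ⧸ Ideal.span {a}) × CyclicSum L) ≃ₗ[k[X]] CyclicSum L') := by
  induction L with
  | nil =>
    intro a ha
    by_cases hu : IsUnit a
    · have : Subsingleton (k[X] ⧸ Ideal.span {a}) :=
        Ideal.Quotient.subsingleton_iff.2 (Ideal.span_singleton_eq_top.2 hu)
      have : Subsingleton (CyclicSum ([] : List k[X])) :=
        ⟨fun x y => funext fun i => i.elim0⟩
      exact ⟨[], hL, by simp, ⟨0, 0, fun _ => Subsingleton.elim _ _,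
        fun _ => Subsingleton.elim _ _⟩⟩
    · obtain ⟨b, hb, hba, ⟨e⟩⟩ := exists_monic_quotSpan_equiv ha
      refine ⟨[b], ⟨by simpa using hb, by simpa [hba.isUnit_iff] using hu, by simp⟩, ?_,
        ⟨(e.prodCongr (.refl _ _)).trans (cyclicSumCons b [])⟩⟩
      intro c hc _ P hP
      obtain rfl : P = b := by simpa using hP
      exact hba.dvd.trans hc
  | cons Q L ih =>
    intro a ha
    have hQ : Q ≠ 0 := (hL.monic Q (by simp)).ne_zero
    obtain ⟨d, l, hd, hl, hda, hdQ, hQl, hlc, ⟨e⟩⟩ := exists_gcd_lcm_quotSpan_equiv ha hQ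
    obtain ⟨m, hm, hml, ⟨f⟩⟩ := exists_monic_quotSpan_equiv hl
    obtain ⟨L', hL', hdvd, ⟨g⟩⟩ := ih ⟨fun P hP => hL.monic P (by simp [hP]),
      fun P hP => hL.not_isUnit P (by simp [hP]), hL.pairwise.of_cons⟩ d hd
    have hLQ := (List.pairwise_cons.1 hL.pairwise).1
    refine ⟨m :: L', ⟨?_, ?_, ?_⟩, ?_, ⟨?_⟩⟩
    · simpa [hm] using hL'.monic
    · have : ¬ IsUnit m := fun h => hL.not_isUnit Q (by simp)
        (isUnit_of_dvd_unit hQl (hml.isUnit_iff.1 h))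
      simpa [this] using hL'.not_isUnit
    · exact List.pairwise_cons.2 ⟨hdvd m ((hdQ.trans hQl).trans hml.symm.dvd)
        fun P hP => ((hLQ P hP).trans hQl).trans hml.symm.dvd, hL'.pairwise⟩
    · intro c hac hc P hP
      have hQc := hc Q (by simp)
      rcases List.mem_cons.1 hP with rfl | hP
      · exact hml.dvd.trans (hlc c hac hQc)
      · exact hdvd c (hda.trans hac) (fun S hS => hc S (by simp [hS])) P hP
    · exact ((LinearEquiv.refl _ _).prodCongr (cyclicSumCons Q L).symm).trans <|
        (LinearEquiv.prodAssoc k[X] _ _ _).symm.trans <|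
        (e.prodCongr (.refl _ _)).trans <|
        (LinearEquiv.prodAssoc k[X] _ _ _).trans <|
        (f.prodCongr g).trans (cyclicSumCons m L')

lemma exists_isInvariantFactors_pi (s : ℕ) (a : Fin s → k[X]) (ha : ∀ i, a i ≠ 0) :
    ∃ L : List k[X], IsInvariantFactors L ∧
      Nonempty ((∀ i, k[X] ⧸ Ideal.span {a i}) ≃ₗ[k[X]] CyclicSum L) := by
  induction s with
  | zero =>
    refine ⟨[], ⟨by simp, by simp, by simp⟩, ⟨0, 0, fun _ => ?_, fun _ => ?_⟩⟩ <;>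
    exact funext fun i => i.elim0
  | succ s ih =>
    obtain ⟨L, hL, ⟨e⟩⟩ := ih (fun i => a i.succ) fun i => ha _
    obtain ⟨L', hL', -, ⟨f⟩⟩ := exists_isInvariantFactors_insert L hL (a 0) (ha 0)
    exact ⟨L', hL', ⟨(Fin.consLinearEquiv k[X] fun i => k[X] ⧸ Ideal.span {a i}).symm.trans <|
      ((LinearEquiv.refl _ _).prodCongr e).trans f⟩⟩

lemma exists_isInvariantFactors_of_isTorsion {M : Type*} [AddCommGroup M] [Module k[X] M]
    [Module.Finite k[X] M] (hM : Module.IsTorsion k[X] M) :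
    ∃ L : List k[X], IsInvariantFactors L ∧ Nonempty (M ≃ₗ[k[X]] CyclicSum L) := by
  classical
  obtain ⟨ι, _, p, hp, e, ⟨f⟩⟩ := Module.equiv_directSum_of_isTorsion hM
  have σ := Fintype.equivFin ι
  obtain ⟨L, hL, ⟨g⟩⟩ := exists_isInvariantFactors_pi (Fintype.card ι)
    (fun i => p (σ.symm i) ^ e (σ.symm i)) fun i => pow_ne_zero _ (hp _).ne_zero
  exact ⟨L, hL, ⟨f.trans <| (DirectSum.linearEquivFunOnFintype k[X] ι _).trans <|
    (LinearEquiv.piCongrLeft k[X] (fun i => k[X] ⧸ Ideal.span {p i ^ e i}) σ.symm).symm.trans g⟩⟩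

/-- The dimension over `k` of the cokernel of multiplication by `D` on a `k[X]`-module. -/
noncomputable def corank (k : Type*) [Field k] (M : Type*) [AddCommGroup M] [Module k[X] M]
    [Module k M] [IsScalarTower k k[X] M] (D : k[X]) : ℕ :=
  Module.finrank k (M ⧸ LinearMap.range (LinearMap.lsmul k[X] M D))

lemma corank_congr {M N : Type*} [AddCommGroup M] [Module k[X] M]
    [Module k M] [IsScalarTower k k[X] M] [AddCommGroup N] [Module k[X] N]
    [Module k N] [IsScalarTower k k[X] N] (e : M ≃ₗ[k[X]] N) (D : k[X]) :
    corank k M D = corank k N D := by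
  refine LinearEquiv.finrank_eq ((Submodule.Quotient.equiv _ _ e ?_).restrictScalars k)
  ext y
  constructor
  · rintro ⟨_, ⟨x, rfl⟩, rfl⟩
    exact ⟨e x, by simp⟩
  · rintro ⟨x, rfl⟩
    exact ⟨D • e.symm x, ⟨e.symm x, rfl⟩, by simp⟩

lemma corank_quotSpan [DecidableEq k] (P D : k[X]) :
    corank k (k[X] ⧸ Ideal.span {P}) D = (gcd P D).natDegree := by
  have h : LinearMap.range (LinearMap.lsmul k[X] (k[X] ⧸ Ideal.span {P}) D) =
      Submodule.map (Submodule.mkQ (Ideal.span {P})) (Ideal.span {D}) := by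
    ext y
    constructor
    · rintro ⟨x, rfl⟩
      obtain ⟨x, rfl⟩ := Submodule.mkQ_surjective _ x
      exact ⟨D * x, Ideal.mul_mem_right _ _ (Ideal.mem_span_singleton_self _), rfl⟩
    · rintro ⟨x, hx, rfl⟩
      obtain ⟨z, rfl⟩ := Ideal.mem_span_singleton.1 hx
      exact ⟨Submodule.mkQ _ z, rfl⟩
  have h2 : Ideal.span {P} ⊔ Ideal.span {D} = Ideal.span {gcd P D} := by
    rw [← Ideal.span_union, Set.singleton_union]
    exact (span_gcd P D).symm
  rw [corank, h, LinearEquiv.finrank_eq (((Submodule.quotientQuotientEquivQuotientSup _ _).trans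
    (Submodule.quotEquivOfEq _ _ h2)).restrictScalars k)]
  exact finrank_quotient_span_eq_natDegree

lemma corank_pi [DecidableEq k] {r : ℕ} (P : Fin r → k[X]) (hP : ∀ i, P i ≠ 0) (D : k[X]) :
    corank k (∀ i, k[X] ⧸ Ideal.span {P i}) D = ∑ i, (gcd (P i) D).natDegree := by
  have h : LinearMap.range (LinearMap.lsmul k[X] (∀ i, k[X] ⧸ Ideal.span {P i}) D) =
      Submodule.pi Set.univ
        fun i => LinearMap.range (LinearMap.lsmul k[X] (k[X] ⧸ Ideal.span {P i}) D) := by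
    ext y
    constructor
    · rintro ⟨x, rfl⟩ i -
      exact ⟨x i, rfl⟩
    · intro hy
      choose x hx using fun i => hy i (Set.mem_univ i)
      exact ⟨x, funext hx⟩
  have hfin (i) : FiniteDimensional k (k[X] ⧸ Ideal.span {P i}) :=
    (AdjoinRoot.powerBasis (hP i)).finite
  have hfree (i) : Module.Free k ((k[X] ⧸ Ideal.span {P i}) ⧸
      LinearMap.range (LinearMap.lsmul k[X] (k[X] ⧸ Ideal.span {P i}) D)) :=
    Module.Free.of_divisionRing k _
  rw [corank, h, LinearEquiv.finrank_eq ((Submodule.quotientPi _).restrictScalars k),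
    Module.finrank_pi_fintype]
  exact Finset.sum_congr rfl fun i _ => corank_quotSpan (P i) D

lemma dvd_of_sum_natDegree_gcd_eq [DecidableEq k] {N m : ℕ} (hm : m < N) {P Q : ℕ → k[X]}
    (hP : ∀ i, (P i).Monic) (hQ : ∀ i j, i ≤ j → Q j ∣ Q i)
    (hPQ : ∀ i < m, P i = Q i)
    (h : ∀ D, ∑ i ∈ Finset.range N, (gcd (P i) D).natDegree =
      ∑ i ∈ Finset.range N, (gcd (Q i) D).natDegree) : P m ∣ Q m := by
  have hle (D : k[X]) (i : ℕ) : (gcd (P i) D).natDegree ≤ (P i).natDegree :=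
    natDegree_le_of_dvd (gcd_dvd_left _ _) (hP i).ne_zero
  have key (i : ℕ) (hi : i ∈ Finset.range N) :
      (gcd (P i) (Q m)).natDegree + (Q i).natDegree ≤
        (gcd (Q i) (Q m)).natDegree + (P i).natDegree := by
    rcases lt_or_ge i m with him | him
    · rw [hPQ i him]
    · have : (gcd (Q i) (Q m)).natDegree = (Q i).natDegree :=
        natDegree_eq_of_degree_eq (degree_eq_degree_of_associated
          (associated_of_dvd_dvd (gcd_dvd_left _ _) (dvd_gcd dvd_rfl (hQ m i him))))
      have := hle (Q m) i
      omega
  have h0 (S : k[X]) : (gcd S 0).natDegree = S.natDegree :=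
    natDegree_eq_of_degree_eq (degree_eq_degree_of_associated
      (associated_of_dvd_dvd (gcd_dvd_left _ _) (dvd_gcd dvd_rfl (dvd_zero _))))
  have hsum := h 0
  simp only [h0] at hsum
  have heq := (Finset.sum_eq_sum_iff_of_le key).1
    (by rw [Finset.sum_add_distrib, Finset.sum_add_distrib, h, hsum]) m (Finset.mem_range.2 hm)
  have hg : (gcd (P m) (Q m)).natDegree = (P m).natDegree := by
    have : (gcd (Q m) (Q m)).natDegree = (Q m).natDegree :=
      natDegree_eq_of_degree_eq (degree_eq_degree_of_associated
        (associated_of_dvd_dvd (gcd_dvd_left _ _) (dvd_gcd dvd_rfl dvd_rfl)))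
    omega
  exact (associated_of_dvd_of_natDegree_le (gcd_dvd_left (P m) (Q m)) (hP m).ne_zero
    hg.ge).symm.dvd.trans (gcd_dvd_right _ _)

lemma eq_of_sum_natDegree_gcd_eq [DecidableEq k] {N : ℕ} {P Q : ℕ → k[X]}
    (hP : ∀ i, (P i).Monic) (hQ : ∀ i, (Q i).Monic)
    (hPdvd : ∀ i j, i ≤ j → P j ∣ P i) (hQdvd : ∀ i j, i ≤ j → Q j ∣ Q i)
    (h : ∀ D, ∑ i ∈ Finset.range N, (gcd (P i) D).natDegree =
      ∑ i ∈ Finset.range N, (gcd (Q i) D).natDegree) (m : ℕ) (hm : m < N) : P m = Q m := by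
  induction m using Nat.strong_induction_on with
  | _ m ih =>
    have ih (i) (hi : i < m) : P i = Q i := ih i hi (hi.trans hm)
    exact eq_of_monic_of_associated (hP m) (hQ m) <| associated_of_dvd_dvd
      (dvd_of_sum_natDegree_gcd_eq hm hP hQdvd ih h)
      (dvd_of_sum_natDegree_gcd_eq hm hQ hPdvd (fun i hi => (ih i hi).symm) fun D => (h D).symm)

/-- Extension of a finite family of polynomials by the constant polynomial `1`. -/
noncomputable def extendOne {r : ℕ} (P : Fin r → k[X]) (i : ℕ) : k[X] :=
  if h : i < r then P ⟨i, h⟩ else 1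

lemma extendOne_monic {r : ℕ} {P : Fin r → k[X]} (hP : ∀ i, (P i).Monic) (i : ℕ) :
    (extendOne P i).Monic := by
  unfold extendOne
  split_ifs
  · exact hP _
  · exact monic_one

lemma extendOne_dvd {r : ℕ} {P : Fin r → k[X]}
    (h : ∀ i : Fin r, ∀ h : (i : ℕ) + 1 < r, P ⟨(i : ℕ) + 1, h⟩ ∣ P i) (i j : ℕ) (hij : i ≤ j) :
    extendOne P j ∣ extendOne P i := by
  induction j, hij using Nat.le_induction with
  | base => rfl
  | succ j hij ih =>
    refine dvd_trans ?_ ih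
    unfold extendOne
    split_ifs with h1 h2
    · exact h ⟨j, h2⟩ h1
    · omega
    · exact one_dvd _
    · rfl

lemma sum_extendOne [DecidableEq k] {r N : ℕ} (hr : r ≤ N) (P : Fin r → k[X]) (D : k[X]) :
    ∑ i ∈ Finset.range N, (gcd (extendOne P i) D).natDegree = ∑ i, (gcd (P i) D).natDegree := by
  obtain ⟨s, rfl⟩ := Nat.exists_eq_add_of_le hr
  rw [Finset.sum_range_add, Finset.sum_range, Finset.sum_eq_zero (s := Finset.range s), add_zero]
  · exact Finset.sum_congr rfl fun i _ => by simp [extendOne]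
  · intro i _
    simp [extendOne]

lemma sigma_eq_of_pi_quotSpan_equiv {r s : ℕ} {P : Fin r → k[X]} {Q : Fin s → k[X]}
    (hP : ∀ i, (P i).Monic ∧ 1 ≤ (P i).natDegree) (hQ : ∀ i, (Q i).Monic ∧ 1 ≤ (Q i).natDegree)
    (hPdvd : ∀ i : Fin r, ∀ h : (i : ℕ) + 1 < r, P ⟨(i : ℕ) + 1, h⟩ ∣ P i)
    (hQdvd : ∀ i : Fin s, ∀ h : (i : ℕ) + 1 < s, Q ⟨(i : ℕ) + 1, h⟩ ∣ Q i)
    (e : (∀ i, k[X] ⧸ Ideal.span {P i}) ≃ₗ[k[X]] (∀ i, k[X] ⧸ Ideal.span {Q i})) :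
    (⟨r, P⟩ : (r : ℕ) × (Fin r → k[X])) = ⟨s, Q⟩ := by
  classical
  have key : ∀ m < r + s, extendOne P m = extendOne Q m := by
    refine eq_of_sum_natDegree_gcd_eq (extendOne_monic fun i => (hP i).1)
      (extendOne_monic fun i => (hQ i).1) (extendOne_dvd hPdvd) (extendOne_dvd hQdvd) fun D => ?_
    rw [sum_extendOne (by omega), sum_extendOne (by omega),
      ← corank_pi P fun i => (hP i).1.ne_zero, ← corank_pi Q fun i => (hQ i).1.ne_zero,
      corank_congr e]
  obtain rfl : r = s := by
    rcases lt_trichotomy r s with h | h | h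
    · have h1 := key r (by omega)
      simp only [extendOne, lt_irrefl, dite_false, h, dite_true] at h1
      have := (hQ ⟨r, h⟩).2
      simp [← h1] at this
    · exact h
    · have h1 := key s (by omega)
      simp only [extendOne, lt_irrefl, dite_false, h, dite_true] at h1
      have := (hP ⟨s, h⟩).2
      simp [h1] at this
  congr
  ext1 i
  simpa [extendOne] using key i (by omega)

lemma exists_conj_eq_toMatrix_iff {n : ℕ} {N : Type*} [AddCommGroup N] [Module k[X] N] [Module k N]
    [IsScalarTower k k[X] N] (b : Module.Basis (Fin n) k N) (A : Matrix (Fin n) (Fin n) k) :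
    (∃ T : (Matrix (Fin n) (Fin n) k)ˣ,
      (↑T⁻¹ : Matrix (Fin n) (Fin n) k) * A * (↑T : Matrix (Fin n) (Fin n) k) =
        LinearMap.toMatrix b b ((LinearMap.lsmul k[X] N X).restrictScalars k)) ↔
    Nonempty (Module.AEval' (Matrix.toLin' A) ≃ₗ[k[X]] N) := by
  have hb (y : N) : b.equivFun ((X : k[X]) • y) =
      (LinearMap.toMatrix b b ((LinearMap.lsmul k[X] N X).restrictScalars k)).mulVec
        (b.equivFun y) :=
    (LinearMap.toMatrix_mulVec_repr b b ((LinearMap.lsmul k[X] N X).restrictScalars k) y).symm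
  constructor
  · rintro ⟨T, hT⟩
    let g : (Fin n → k) ≃ₗ[k] (Fin n → k) := Matrix.toLin'OfInv T.mul_inv T.inv_mul
    have hg (v) : g v = (↑T⁻¹ : Matrix (Fin n) (Fin n) k).mulVec v := Matrix.toLin'_apply _ v
    refine ⟨LinearEquiv.ofAEval _ (g.trans b.equivFun.symm) fun v => b.equivFun.injective ?_⟩
    rw [hb, ← hT]
    simp only [LinearEquiv.trans_apply, LinearEquiv.apply_symm_apply, hg, Matrix.mulVec_mulVec,
      mul_assoc, Units.mul_inv, mul_one]
    simp [Matrix.mulVec_mulVec]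
  · rintro ⟨e⟩
    let g : (Fin n → k) ≃ₗ[k] (Fin n → k) :=
      (Module.AEval'.of (Matrix.toLin' A)).trans ((e.restrictScalars k).trans b.equivFun)
    have hg (v) : g (A.mulVec v) = (LinearMap.toMatrix b b
        ((LinearMap.lsmul k[X] N X).restrictScalars k)).mulVec (g v) := by
      simp only [g, LinearEquiv.trans_apply, LinearEquiv.restrictScalars_apply]
      rw [← hb, ← map_smul, Module.AEval'.X_smul_of, Matrix.toLin'_apply]
    refine ⟨⟨LinearMap.toMatrix' g.symm.toLinearMap, LinearMap.toMatrix' g.toLinearMap, ?_, ?_⟩, ?_⟩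
    · rw [← LinearMap.toMatrix'_comp]; simp
    · rw [← LinearMap.toMatrix'_comp]; simp
    · apply Matrix.toLin'.injective
      ext1 v
      ext1
      simp [Matrix.toLin'_mul, hg]

/-- The basis of `k[X] / (P)` formed by the powers of `X`. -/
noncomputable def quotSpanBasis {P : k[X]} (hP : P.Monic) :
    Module.Basis (Fin P.natDegree) k (k[X] ⧸ Ideal.span {P}) :=
  AdjoinRoot.powerBasisAux' hP

lemma powerBasisAux'_repr_root_mul {P : k[X]} (hP : P.Monic) (i j : Fin P.natDegree) :
    (AdjoinRoot.powerBasisAux' hP).repr (AdjoinRoot.root P * AdjoinRoot.powerBasisAux' hP j) i =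
      if (j : ℕ) + 1 = P.natDegree then -P.coeff i else if (i : ℕ) = j + 1 then 1 else 0 := by
  have hg : (AdjoinRoot.powerBasis' hP).minpolyGen = P := by
    rw [PowerBasis.minpolyGen_eq, AdjoinRoot.powerBasis'_gen, AdjoinRoot.minpoly_root hP.ne_zero,
      hP.leadingCoeff, inv_one, C_1, mul_one]
  have h := congrFun₂ (AdjoinRoot.powerBasis' hP).leftMulMatrix i j
  rw [hg] at h
  rw [← Algebra.leftMulMatrix_eq_repr_mul]
  exact h

lemma quotSpanBasis_repr_X_smul {P : k[X]} (hP : P.Monic) (i j : Fin P.natDegree) :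
    (quotSpanBasis hP).repr ((X : k[X]) • quotSpanBasis hP j) i =
      if (j : ℕ) + 1 = P.natDegree then -P.coeff i else if (i : ℕ) = j + 1 then 1 else 0 := by
  have hX (y : AdjoinRoot P) : (show AdjoinRoot P from
      (X : k[X]) • (show k[X] ⧸ Ideal.span {P} from y)) = AdjoinRoot.root P * y := by
    induction y using AdjoinRoot.induction_on
    rfl
  rw [← powerBasisAux'_repr_root_mul hP, ← hX]
  rfl

/-- The basis of `∏ k[X] / (P i)` formed by the powers of `X` in each factor. -/
noncomputable def piQuotSpanBasis {r : ℕ} {P : Fin r → k[X]} (hP : ∀ i, (P i).Monic) :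
    Module.Basis ((i : Fin r) × Fin (P i).natDegree) k (∀ i, k[X] ⧸ Ideal.span {P i}) :=
  Pi.basis fun i => quotSpanBasis (hP i)

lemma piQuotSpanBasis_repr_X_smul {r : ℕ} {P : Fin r → k[X]} (hP : ∀ i, (P i).Monic)
    (x y : (i : Fin r) × Fin (P i).natDegree) :
    (piQuotSpanBasis hP).repr ((X : k[X]) • piQuotSpanBasis hP y) x =
      if x.1 = y.1 then
        if (y.2 : ℕ) + 1 = (P y.1).natDegree then -(P y.1).coeff x.2
        else if (x.2 : ℕ) = y.2 + 1 then 1 else 0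
      else 0 := by
  obtain ⟨i, a⟩ := x
  obtain ⟨j, b⟩ := y
  rw [piQuotSpanBasis, Pi.basis_repr, Pi.basis_apply]
  by_cases h : i = j
  · subst h
    simp [quotSpanBasis_repr_X_smul]
  · simp [h]

lemma blockOf_add {r : ℕ} {p : ℕ → ℕ} {b j : ℕ} (hb : b < r) (hj : j < p b) :
    blockOf p r (∑ t ∈ Finset.range b, p t + j) = b := by
  have : ((Finset.range r).filter fun c =>
      ∑ t ∈ Finset.range (c + 1), p t ≤ ∑ t ∈ Finset.range b, p t + j) = Finset.range b := by
    ext c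
    simp only [Finset.mem_filter, Finset.mem_range]
    constructor
    · rintro ⟨-, h⟩
      by_contra! hbc
      have := Finset.sum_le_sum_of_subset (f := p) 
        (Finset.range_mono (Nat.add_le_add_right hbc 1))
      rw [Finset.sum_range_succ] at this
      omega
    · intro h
      refine ⟨h.trans hb, le_add_right ?_⟩
      exact Finset.sum_le_sum_of_subset (Finset.range_mono h)
  rw [blockOf, this, Finset.card_range]

lemma toMatrix_piQuotSpanBasis {r n : ℕ} {P : Fin r → k[X]} (hP : ∀ i, (P i).Monic)
    (hn : ∑ i, (P i).natDegree = n) :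
    LinearMap.toMatrix ((piQuotSpanBasis hP).reindex (finSigmaFinEquiv.trans (finCongr hn)))
      ((piQuotSpanBasis hP).reindex (finSigmaFinEquiv.trans (finCongr hn)))
      ((LinearMap.lsmul k[X] (∀ i, k[X] ⧸ Ideal.span {P i}) X).restrictScalars k) =
    ratNormalForm r (fun j => if h : j < r then (P ⟨j, h⟩).natDegree else 0)
      (fun j => if h : j < r then P ⟨j, h⟩ else 0) n := by
  set p : ℕ → ℕ := fun j => if h : j < r then (P ⟨j, h⟩).natDegree else 0 with hp
  have hpP (i : Fin r) : p i = (P i).natDegree := by simp [hp]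
  set σ := finSigmaFinEquiv.trans (finCongr hn)
  have hσ (x) : (σ x : ℕ) = ∑ t ∈ Finset.range x.1, p t + x.2 := by
    simp only [σ, Equiv.trans_apply, finCongr_apply, Fin.val_cast, finSigmaFinEquiv_apply,
      Finset.sum_range, ← hpP]
    rfl
  have hblock (x) : blockOf p r (σ x) = x.1 := by
    rw [hσ]
    exact blockOf_add x.1.2 ((hpP _).symm ▸ x.2.2)
  ext s t
  obtain ⟨x, rfl⟩ := σ.surjective s
  obtain ⟨y, rfl⟩ := σ.surjective t
  have hy := y.2.2
  rw [LinearMap.toMatrix_apply, Module.Basis.repr_reindex_apply, Module.Basis.reindex_apply,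
    Equiv.symm_apply_apply, Equiv.symm_apply_apply]
  refine (piQuotSpanBasis_repr_X_smul hP x y).trans ?_
  simp only [ratNormalForm, Matrix.of_apply, hblock, Fin.val_inj, hpP, Fin.is_lt, dite_true, Fin.eta]
  simp only [hσ]
  by_cases h : x.1 = y.1
  · have h1 : ((y.2 : ℕ) + 1 = (P y.1).natDegree) ↔ (∑ t ∈ Finset.range y.1, p t + y.2 =
        ∑ t ∈ Finset.range y.1, p t + (P y.1).natDegree - 1) := by omega
    have h2 : ((x.2 : ℕ) = y.2 + 1) ↔ (∑ t ∈ Finset.range y.1, p t + (x.2 : ℕ) =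
        ∑ t ∈ Finset.range y.1, p t + y.2 + 1) := by omega
    simp only [h, if_true, ← h1, ← h2, Nat.add_sub_cancel_left]
  · simp [h]

lemma exists_conj_eq_ratNormalForm_iff {r n : ℕ} {P : Fin r → k[X]} (hP : ∀ i, (P i).Monic)
    (hn : ∑ i, (P i).natDegree = n) (A : Matrix (Fin n) (Fin n) k) :
    (∃ T : (Matrix (Fin n) (Fin n) k)ˣ,
      (↑T⁻¹ : Matrix (Fin n) (Fin n) k) * A * (↑T : Matrix (Fin n) (Fin n) k) =
        ratNormalForm r (fun j => if h : j < r then (P ⟨j, h⟩).natDegree else 0)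
          (fun j => if h : j < r then P ⟨j, h⟩ else 0) n) ↔
    Nonempty (Module.AEval' (Matrix.toLin' A) ≃ₗ[k[X]] ∀ i, k[X] ⧸ Ideal.span {P i}) := by
  rw [← toMatrix_piQuotSpanBasis hP hn]
  exact exists_conj_eq_toMatrix_iff _ A

lemma sum_natDegree_eq_of_equiv {r n : ℕ} {P : Fin r → k[X]} (hP : ∀ i, (P i).Monic)
    {A : Matrix (Fin n) (Fin n) k}
    (e : Module.AEval' (Matrix.toLin' A) ≃ₗ[k[X]] ∀ i, k[X] ⧸ Ideal.span {P i}) :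
    ∑ i, (P i).natDegree = n := by
  have h := ((Module.AEval'.of (Matrix.toLin' A)).trans (e.restrictScalars k)).finrank_eq
  rw [Module.finrank_fin_fun, Module.finrank_eq_card_basis (piQuotSpanBasis hP)] at h
  simpa using h.symm

end RationalNormalForm

/-- every matrix `A ∈ k^{n×n}` is similar over `k` to exactly one rational
normal form: there is a unique pair of an `r ≥ 1` and monic polynomials `P 0, …, P (r-1)`
of degrees `≥ 1` with `P (i+1) ∣ P i`, whose degrees sum to `n`, such that `A` is similar
to the block diagonal matrix with blocks the companion matrices `B(P 0), …, B(P (r-1))`. -/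
theorem stmt4 {k : Type*} [Field k] {n : ℕ} (hn : 1 ≤ n) (A : Matrix (Fin n) (Fin n) k) :
    ∃! rP : (r : ℕ) × (Fin r → Polynomial k),
      1 ≤ rP.1 ∧
      (∀ i, (rP.2 i).Monic ∧ 1 ≤ (rP.2 i).natDegree) ∧
      (∀ i : Fin rP.1, ∀ h : (i : ℕ) + 1 < rP.1, rP.2 ⟨(i : ℕ) + 1, h⟩ ∣ rP.2 i) ∧
      (∑ i, (rP.2 i).natDegree) = n ∧
      ∃ T : (Matrix (Fin n) (Fin n) k)ˣ,
        (↑T⁻¹ : Matrix (Fin n) (Fin n) k) * A * (↑T : Matrix (Fin n) (Fin n) k) =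
          ratNormalForm rP.1
            (fun j => if h : j < rP.1 then (rP.2 ⟨j, h⟩).natDegree else 0)
            (fun j => if h : j < rP.1 then rP.2 ⟨j, h⟩ else 0) n := by
  obtain ⟨L, hL, ⟨e⟩⟩ := exists_isInvariantFactors_of_isTorsion
    (Module.AEval.isTorsion_of_finiteDimensional k (Fin n → k) (Matrix.toLin' A))
  have hmonic (i) : (L.get i).Monic := hL.monic _ (L.get_mem i)
  have hsum := sum_natDegree_eq_of_equiv hmonic e
  have hdeg (i) : 1 ≤ (L.get i).natDegree :=
    Nat.one_le_iff_ne_zero.2 fun h => hL.not_isUnit _ (L.get_mem i)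
      ((hmonic i).natDegree_eq_zero.1 h ▸ isUnit_one)
  have hdvd (i : Fin L.length) (h : (i : ℕ) + 1 < L.length) : L.get ⟨(i : ℕ) + 1, h⟩ ∣ L.get i :=
    List.pairwise_iff_get.1 hL.pairwise _ _ (Fin.mk_lt_mk.2 (Nat.lt_succ_self i))
  refine ⟨⟨L.length, L.get⟩, ⟨?_, fun i => ⟨hmonic i, hdeg i⟩, hdvd, hsum,
    (exists_conj_eq_ratNormalForm_iff hmonic hsum A).2 ⟨e⟩⟩, ?_⟩
  · by_contra! h
    obtain rfl : L = [] := List.length_eq_zero_iff.1 (Nat.lt_one_iff.1 h)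
    simp at hsum
    omega
  · rintro ⟨r, P⟩ ⟨-, hP, hPdvd, hPsum, hT⟩
    obtain ⟨f⟩ := (exists_conj_eq_ratNormalForm_iff (fun i => (hP i).1) hPsum A).1 hT
    exact sigma_eq_of_pi_quotSpan_equiv hP (fun i => ⟨hmonic i, hdeg i⟩) hPdvd hdvd
      (f.symm.trans e)
end

section
/- Let G be a group acting on a topological space X, and suppose that for every constructible subset S of X the saturation G·S = {g·x : g ∈ G, x ∈ S} is again constructible. Assume there exist finitely many constructible subsets N_1, …, N_r of X such that every G-orbit meets the union N_1 ∪ … ∪ N_r in at least one point, and every G-orbit meets each individual N_j in at most one point. Then there exists a constructible subset N of X that meets every G-orbit in exactly one point. -/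
/-- A subset of a topological space is constructible if it is a finite union of locally
closed subsets. -/
def IsConstructibleSet {X : Type*} [TopologicalSpace X] (S : Set X) : Prop :=
  ∃ F : Finset (Set X), (∀ T ∈ F, IsLocallyClosed T) ∧ S = ⋃ T ∈ F, T

namespace IsConstructibleSet

variable {X : Type*} [TopologicalSpace X] {S T : Set X}

theorem of_isLocallyClosed (hS : IsLocallyClosed S) : IsConstructibleSet S :=
  ⟨{S}, by simpa using hS, by simp⟩

theorem empty : IsConstructibleSet (∅ : Set X) :=
  ⟨∅, by simp, by simp⟩

theorem union (hS : IsConstructibleSet S) (hT : IsConstructibleSet T) :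
    IsConstructibleSet (S ∪ T) := by
  classical
  obtain ⟨F, hF, rfl⟩ := hS
  obtain ⟨F', hF', rfl⟩ := hT
  refine ⟨F ∪ F', fun A hA => ?_, (Finset.set_biUnion_union F F' id).symm⟩
  exact (Finset.mem_union.1 hA).elim (hF A) (hF' A)

theorem inter (hS : IsConstructibleSet S) (hT : IsConstructibleSet T) :
    IsConstructibleSet (S ∩ T) := by
  classical
  obtain ⟨F, hF, rfl⟩ := hS
  obtain ⟨F', hF', rfl⟩ := hT
  refine ⟨Finset.image₂ (· ∩ ·) F F', fun A hA => ?_, ?_⟩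
  · obtain ⟨B, hB, C, hC, rfl⟩ := Finset.mem_image₂.1 hA
    exact (hF B hB).inter (hF' C hC)
  · ext x
    simp only [Set.mem_inter_iff, Set.mem_iUnion, Finset.mem_image₂, exists_prop]
    constructor
    · rintro ⟨⟨B, hB, hxB⟩, C, hC, hxC⟩
      exact ⟨B ∩ C, ⟨B, hB, C, hC, rfl⟩, hxB, hxC⟩
    · rintro ⟨_, ⟨B, hB, C, hC, rfl⟩, hxB, hxC⟩
      exact ⟨⟨B, hB, hxB⟩, C, hC, hxC⟩

theorem compl (hS : IsConstructibleSet S) : IsConstructibleSet Sᶜ := by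
  classical
  obtain ⟨F, hF, rfl⟩ := hS
  induction F using Finset.induction_on with
  | empty => simpa using of_isLocallyClosed isOpen_univ.isLocallyClosed
  | insert A F _ ih =>
    rw [Finset.set_biUnion_insert, Set.compl_union]
    refine inter ?_ (ih fun B hB => hF B (Finset.mem_insert_of_mem hB))
    obtain ⟨U, Z, hU, hZ, rfl⟩ := hF A (Finset.mem_insert_self A F)
    rw [Set.compl_inter]
    exact (of_isLocallyClosed hU.isClosed_compl.isLocallyClosed).union
      (of_isLocallyClosed hZ.isOpen_compl.isLocallyClosed)

theorem diff (hS : IsConstructibleSet S) (hT : IsConstructibleSet T) :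
    IsConstructibleSet (S \ T) :=
  hS.inter hT.compl

/-- Constructible partial transversals `N i`, for `i` in a finite set, can be merged into a single
constructible partial transversal meeting every orbit that meets one of them. -/
theorem exists_partial_transversal {G ι : Type*} [Group G] [MulAction G X]
    (hsat : ∀ S : Set X, IsConstructibleSet S →
      IsConstructibleSet {y | ∃ g : G, ∃ x ∈ S, y = g • x})
    (N : ι → Set X) (hN : ∀ i, IsConstructibleSet (N i))
    (honce : ∀ (x : X) (i : ι), (MulAction.orbit G x ∩ N i).Subsingleton) (s : Finset ι) :
    ∃ N' : Set X, IsConstructibleSet N' ∧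
      (∀ x : X, (MulAction.orbit G x ∩ N').Subsingleton) ∧
      ∀ x : X, ∀ i ∈ s, (MulAction.orbit G x ∩ N i).Nonempty →
        (MulAction.orbit G x ∩ N').Nonempty := by
  classical
  induction s using Finset.induction_on with
  | empty => exact ⟨∅, empty, by simp, by simp⟩
  | insert i s _ ih =>
    obtain ⟨M, hM, hMonce, hMhit⟩ := ih
    have mem_saturation : ∀ x y z : X, y ∈ MulAction.orbit G x → z ∈ MulAction.orbit G x →
        y ∈ M → z ∈ {y | ∃ g : G, ∃ x ∈ M, y = g • x} := by
      rintro x _ _ ⟨g, rfl⟩ ⟨h, rfl⟩ hy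
      exact ⟨h * g⁻¹, _, hy, by simp [mul_smul]⟩
    refine ⟨M ∪ (N i \ {y | ∃ g : G, ∃ x ∈ M, y = g • x}),
      hM.union ((hN i).diff (hsat M hM)), ?_, ?_⟩
    · rintro x y ⟨hy, hyM | ⟨hyN, hyM⟩⟩ z ⟨hz, hzM | ⟨hzN, hzM⟩⟩
      · exact hMonce x ⟨hy, hyM⟩ ⟨hz, hzM⟩
      · exact absurd (mem_saturation x y z hy hz hyM) hzM
      · exact absurd (mem_saturation x z y hz hy hzM) hyM
      · exact honce x i ⟨hy, hyN⟩ ⟨hz, hzN⟩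
    · intro x j hj hne
      rcases Finset.mem_insert.1 hj with rfl | hj
      · obtain ⟨y, hy, hyN⟩ := hne
        by_cases hyM : y ∈ {y | ∃ g : G, ∃ x ∈ M, y = g • x}
        · obtain ⟨g, z, hz, rfl⟩ := hyM
          exact ⟨z, by simpa using MulAction.mem_orbit_of_mem_orbit g⁻¹ hy, Or.inl hz⟩
        · exact ⟨y, hy, Or.inr ⟨hyN, hyM⟩⟩
      · obtain ⟨y, hy, hyM⟩ := hMhit x j hj hne
        exact ⟨y, hy, Or.inl hyM⟩

end IsConstructibleSet

/-- if a group `G` acts on a topological space `X` so that saturations of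
constructible sets are constructible, and there are finitely many constructible sets
`N 1, …, N r` such that every orbit meets their union at least once but each `N i` at
most once, then some constructible set meets every orbit exactly once. -/
theorem stmt6 {G X : Type*} [Group G] [TopologicalSpace X] [MulAction G X]
    (hsat : ∀ S : Set X, IsConstructibleSet S →
      IsConstructibleSet {y | ∃ g : G, ∃ x ∈ S, y = g • x})
    (r : ℕ) (N : Fin r → Set X) (hN : ∀ i, IsConstructibleSet (N i))
    (hhit : ∀ x : X, ∃ y ∈ MulAction.orbit G x, y ∈ ⋃ i, N i)
    (honce : ∀ (x : X) (i : Fin r), (MulAction.orbit G x ∩ N i).Subsingleton) :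
    ∃ N' : Set X, IsConstructibleSet N' ∧
      ∀ x : X, ∃! y : X, y ∈ MulAction.orbit G x ∩ N' := by
  obtain ⟨M, hM, hMonce, hMhit⟩ :=
    IsConstructibleSet.exists_partial_transversal hsat N hN honce Finset.univ
  refine ⟨M, hM, fun x => ?_⟩
  obtain ⟨y, hy, hyN⟩ := hhit x
  obtain ⟨i, hi⟩ := Set.mem_iUnion.1 hyN
  obtain ⟨z, hz⟩ := hMhit x i (Finset.mem_univ i) ⟨y, hy, hi⟩
  exact ⟨z, hz, fun w hw => hMonce x hw hz⟩
end
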